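/- arXiv:math/0611579 — 15 statements merged into one kernel-verified Lean document; each statement's English description precedes it below -/
import Mathlib

section
/- Let M be a matroid on a finite set E with circuit family 𝒞, and let ℬ ⊆ 𝒞. If T(ℬ) and T(𝒞) contain exactly the same 0/1-vectors (vectors x : E → ℝ with every coordinate equal to 0 or 1), then T(ℬ) = T(𝒞); that is, to verify that ℬ is a tropical basis of M it suffices to check equality on 0/1-points. -/
/-- The minimum of `x` over `C` is attained by at least two distinct elements of `C`. -/
def AttainsMinTwice {α : Type*} (C : Set α) (x : α → ℝ) : Prop :=
  ∃ i ∈ C, ∃ j ∈ C, i ≠ j ∧ x i = x j ∧ ∀ k ∈ C, x i ≤ x k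

/-- `tropT ℬ` is the intersection of the sets `T(C)` for `C ∈ ℬ` (all of `ℝ^α` if `ℬ = ∅`). -/
def tropT {α : Type*} (ℬ : Set (Set α)) : Set (α → ℝ) :=
  {x | ∀ C ∈ ℬ, AttainsMinTwice C x}

/-- A circuit of a matroid: a minimal dependent set. -/
def MatroidCircuit {α : Type*} (M : Matroid α) (C : Set α) : Prop := Minimal M.Dep C

/-- Attaining the minimum twice is preserved by composing with a monotone function. -/
theorem AttainsMinTwice.comp_monotone {α : Type*} {C : Set α} {x : α → ℝ}
    (h : AttainsMinTwice C x) {f : ℝ → ℝ} (hf : Monotone f) : AttainsMinTwice C (f ∘ x) := by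
  obtain ⟨i, hi, j, hj, hij, hx, hmin⟩ := h
  exact ⟨i, hi, j, hj, hij, congrArg f hx, fun k hk => hf (hmin k hk)⟩

/-- If `i` minimizes `x` over `C` and `f` is strictly larger above `x i` than at `x i`, then `x`
attains its minimum over `C` twice as soon as `f ∘ x` does. -/
theorem AttainsMinTwice.of_comp {α : Type*} {C : Set α} {x : α → ℝ} {i : α} (hi : i ∈ C)
    (hmin : ∀ k ∈ C, x i ≤ x k) {f : ℝ → ℝ} (hf : ∀ s, x i < s → f (x i) < f s)
    (h : AttainsMinTwice C (f ∘ x)) : AttainsMinTwice C x := by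
  obtain ⟨p, hp, q, hq, hpq, hfpq, hfmin⟩ := h
  have eq_of_le : ∀ k ∈ C, f (x k) ≤ f (x i) → x k = x i := fun k hk hle =>
    le_antisymm (not_lt.1 fun hlt => (hf _ hlt).not_ge hle) (hmin k hk)
  have hxp : x p = x i := eq_of_le p hp (hfmin i hi)
  have hxq : x q = x i := eq_of_le q hq (hfpq.symm.le.trans (hfmin i hi))
  exact ⟨p, hp, q, hq, hpq, hxp.trans hxq.symm, fun k hk => hxp.le.trans (hmin k hk)⟩

theorem tropT_anti {α : Type*} {𝒜 ℬ : Set (Set α)} (h : 𝒜 ⊆ ℬ) : tropT ℬ ⊆ tropT 𝒜 :=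
  fun _ hx C hC => hx C (h hC)

theorem MatroidCircuit.nonempty {α : Type*} {M : Matroid α} {C : Set α}
    (hC : MatroidCircuit M C) : C.Nonempty :=
  hC.prop.nonempty

/-- for a matroid `M` on a finite set with circuit family `𝒞` and `ℬ ⊆ 𝒞`,
if `T(ℬ)` and `T(𝒞)` contain exactly the same 0/1-vectors, then `T(ℬ) = T(𝒞)`. -/
theorem stmt1 {α : Type*} [Fintype α] (M : Matroid α) (𝒞 : Set (Set α))
    (h𝒞 : 𝒞 = {C | MatroidCircuit M C}) (ℬ : Set (Set α)) (hℬ : ℬ ⊆ 𝒞)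
    (h01 : ∀ x : α → ℝ, (∀ i, x i = 0 ∨ x i = 1) → (x ∈ tropT ℬ ↔ x ∈ tropT 𝒞)) :
    tropT ℬ = tropT 𝒞 := by
  refine (tropT_anti hℬ).antisymm' fun x hx C hC => ?_
  have hne : C.Nonempty := by
    subst h𝒞
    exact MatroidCircuit.nonempty hC
  obtain ⟨i, hi, hmin⟩ := C.exists_min_image x C.toFinite hne
  let f : ℝ → ℝ := fun s => if s ≤ x i then 0 else 1
  have hf : Monotone f := by
    intro a b hab
    simp only [f]
    split_ifs <;> linarith
  have hlt : ∀ s, x i < s → f (x i) < f s := fun s hs => by simp [f, hs.not_ge]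
  have hfx : f ∘ x ∈ tropT 𝒞 :=
    (h01 _ fun j => by simp only [f, Function.comp_apply]; split_ifs <;> simp).1
      fun B hB => (hx B hB).comp_monotone hf
  exact (hfx C hC).of_comp hi hmin hlt
end

section
/- Let E be a finite set, let A, B ⊆ E be subsets whose intersection is a single element, A ∩ B = {e}, and let x : E → ℝ. If the minimum of x over A is attained by at least two distinct elements of A and the minimum of x over B is attained by at least two distinct elements of B, then the minimum of x over the symmetric difference A △ B = (A ∪ B) \ {e} is attained by at least two distinct elements of A △ B. -/
/-- A set on which the minimum is attained twice has a minimizer different from any given point. -/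
theorem AttainsMinTwice.exists_ne {α : Type*} {C : Set α} {x : α → ℝ}
    (h : AttainsMinTwice C x) (e : α) : ∃ i ∈ C, i ≠ e ∧ ∀ k ∈ C, x i ≤ x k := by
  obtain ⟨i, hi, j, hj, hij, hx, hmin⟩ := h
  by_cases hie : i = e
  · exact ⟨j, hj, fun hje => hij (hie.trans hje.symm), fun k hk => hx ▸ hmin k hk⟩
  · exact ⟨i, hi, hie, hmin⟩

/-- Pasting along `e` when the minimum over `A` is at most the minimum over `B`. -/
theorem AttainsMinTwice.symmDiff_of_le {α : Type*} {A B : Set α} {e b : α} {x : α → ℝ}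
    (hAB : A ∩ B = {e}) (hA : AttainsMinTwice A x) (hb : b ∈ B) (hbe : b ≠ e)
    (hbmin : ∀ k ∈ B, x b ≤ x k) (hle : ∀ a ∈ A, (∀ k ∈ A, x a ≤ x k) → x a ≤ x b) :
    AttainsMinTwice (symmDiff A B) x := by
  have mem_iff : ∀ k, k ∈ A ∧ k ∈ B ↔ k = e := fun k => by
    rw [← Set.mem_inter_iff, hAB, Set.mem_singleton_iff]
  have left : ∀ k ∈ A, k ≠ e → k ∈ symmDiff A B := fun k hk hke =>
    Or.inl ⟨hk, fun hkB => hke ((mem_iff k).1 ⟨hk, hkB⟩)⟩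
  have lower : ∀ a ∈ A, (∀ k ∈ A, x a ≤ x k) → ∀ k ∈ symmDiff A B, x a ≤ x k := by
    rintro a ha hmin k (⟨hk, -⟩ | ⟨hk, -⟩)
    · exact hmin k hk
    · exact (hle a ha hmin).trans (hbmin k hk)
  obtain ⟨heA, heB⟩ := (mem_iff e).2 rfl
  by_cases he : ∀ k ∈ A, x e ≤ x k
  · obtain ⟨a, ha, hae, hmin⟩ := hA.exists_ne e
    have hbA : b ∉ A := fun h => hbe ((mem_iff b).1 ⟨h, hb⟩)
    refine ⟨a, left a ha hae, b, Or.inr ⟨hb, hbA⟩, fun h => hbA (h ▸ ha), ?_, lower a ha hmin⟩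
    exact le_antisymm (hle a ha hmin) ((hbmin e heB).trans (he a ha))
  · obtain ⟨i, hi, j, hj, hij, hx, hmin⟩ := hA
    refine ⟨i, left i hi ?_, j, left j hj ?_, hij, hx, lower i hi hmin⟩
    · rintro rfl
      exact he hmin
    · rintro rfl
      exact he fun k hk => hx ▸ hmin k hk

/-- if `A ∩ B = {e}` and `x` attains its minimum at least twice on each of
`A` and `B`, then `x` attains its minimum at least twice on the symmetric difference
`A ∆ B = (A ∪ B) \ {e}`. -/
theorem stmt2 {α : Type*} [Fintype α] (A B : Set α) (e : α) (hAB : A ∩ B = {e})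
    (x : α → ℝ) (hA : AttainsMinTwice A x) (hB : AttainsMinTwice B x) :
    AttainsMinTwice (symmDiff A B) x := by
  obtain ⟨a, ha, hae, hamin⟩ := hA.exists_ne e
  obtain ⟨b, hb, hbe, hbmin⟩ := hB.exists_ne e
  rcases le_total (x a) (x b) with hab | hba
  · exact hA.symmDiff_of_le hAB hb hbe hbmin fun c _ hc => (hc a ha).trans hab
  · rw [symmDiff_comm]
    exact hB.symmDiff_of_le (Set.inter_comm A B ▸ hAB) ha hae hamin
      fun c _ hc => (hc b hb).trans hba
end

section
/- Let M be a matroid on a finite set E with circuit family 𝒞, and let 𝒮 ⊆ 𝒞. Define the pasting closure of 𝒮 to be the smallest family of subsets of E containing 𝒮 and closed under the operation that takes two members A, B with A ∩ B = {e} a single element and adds their symmetric difference A △ B. If every circuit of M belongs to the pasting closure of 𝒮, then 𝒮 is a tropical basis of M. -/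
/-- The pasting closure of a family `𝒮`: the smallest family containing `𝒮` and closed
under taking the symmetric difference `A ∆ B` of two members with `A ∩ B = {e}` a
single element. -/
inductive PastingClosure {α : Type*} (𝒮 : Set (Set α)) : Set α → Prop
  | base {C : Set α} : C ∈ 𝒮 → PastingClosure 𝒮 C
  | paste {A B : Set α} {e : α} : PastingClosure 𝒮 A → PastingClosure 𝒮 B →
      A ∩ B = {e} → PastingClosure 𝒮 (symmDiff A B)

/-- If the minimum over `A` is at most that over `B`, pasting preserves attaining the minimum
twice. -/
theorem attainsMinTwice_symmDiff_of_le {α : Type*} {A B : Set α} {e i j k l : α} {x : α → ℝ}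
    (hAB : A ∩ B = {e}) (hi : i ∈ A) (hj : j ∈ A) (hij : i ≠ j) (hxij : x i = x j)
    (hA : ∀ a ∈ A, x i ≤ x a) (hk : k ∈ B) (hl : l ∈ B) (hkl : k ≠ l) (hxkl : x k = x l)
    (hB : ∀ b ∈ B, x k ≤ x b) (hik : x i ≤ x k) :
    AttainsMinTwice (symmDiff A B) x := by
  have mem_iff : ∀ a, a ∈ A ∧ a ∈ B ↔ a = e := fun a => by
    rw [← Set.mem_inter_iff, hAB, Set.mem_singleton_iff]
  have heB : e ∈ B := ((mem_iff e).2 rfl).2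
  have left_mem : ∀ a ∈ A, a ≠ e → a ∈ symmDiff A B := fun a ha hne =>
    Set.mem_symmDiff.2 (Or.inl ⟨ha, fun hb => hne ((mem_iff a).1 ⟨ha, hb⟩)⟩)
  have right_mem : ∀ b ∈ B, b ≠ e → b ∈ symmDiff A B := fun b hb hne =>
    Set.mem_symmDiff.2 (Or.inr ⟨hb, fun ha => hne ((mem_iff b).1 ⟨ha, hb⟩)⟩)
  have lower : ∀ c ∈ symmDiff A B, x i ≤ x c := by
    intro c hc
    rcases Set.mem_symmDiff.1 hc with h | h
    · exact hA c h.1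
    · exact hik.trans (hB c h.1)
  -- If `e` is a minimizer over `A`, then `e` also minimizes over `B`.
  have shared : ∀ a ∈ A, a ≠ e → x a = x i → x e = x i →
      AttainsMinTwice (symmDiff A B) x := by
    intro a ha hne hxa hxe
    have hki : x k = x i := le_antisymm (hxe ▸ hB e heB) hik
    obtain ⟨b, hb, hbe, hxb⟩ : ∃ b ∈ B, b ≠ e ∧ x b = x i := by
      by_cases hke : k = e
      · exact ⟨l, hl, fun h => hkl (hke.trans h.symm), hxkl.symm.trans hki⟩
      · exact ⟨k, hk, hke, hki⟩
    refine ⟨a, left_mem a ha hne, b, right_mem b hb hbe, ?_, hxa.trans hxb.symm, ?_⟩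
    · rintro rfl
      exact hne ((mem_iff a).1 ⟨ha, hb⟩)
    · exact fun c hc => hxa ▸ lower c hc
  by_cases hie : i = e
  · exact shared j hj (fun h => hij (hie.trans h.symm)) hxij.symm (by rw [hie])
  by_cases hje : j = e
  · exact shared i hi hie rfl (by rw [hxij, hje])
  exact ⟨i, left_mem i hi hie, j, left_mem j hj hje, hij, hxij, lower⟩

theorem AttainsMinTwice.paste {α : Type*} {A B : Set α} {e : α} {x : α → ℝ}
    (hA : AttainsMinTwice A x) (hB : AttainsMinTwice B x) (hAB : A ∩ B = {e}) :
    AttainsMinTwice (symmDiff A B) x := by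
  obtain ⟨i, hi, j, hj, hij, hxij, hmA⟩ := hA
  obtain ⟨k, hk, l, hl, hkl, hxkl, hmB⟩ := hB
  rcases le_total (x i) (x k) with h | h
  · exact attainsMinTwice_symmDiff_of_le hAB hi hj hij hxij hmA hk hl hkl hxkl hmB h
  · rw [symmDiff_comm]
    rw [Set.inter_comm] at hAB
    exact attainsMinTwice_symmDiff_of_le hAB hk hl hkl hxkl hmB hi hj hij hxij hmA h

theorem PastingClosure.attainsMinTwice {α : Type*} {𝒮 : Set (Set α)} {C : Set α} {x : α → ℝ}
    (hC : PastingClosure 𝒮 C) (hx : x ∈ tropT 𝒮) : AttainsMinTwice C x := by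
  induction hC with
  | base h => exact hx _ h
  | paste _ _ hAB hA hB => exact hA.paste hB hAB

/-- if every circuit of a matroid `M` lies in the pasting closure of a
subfamily `𝒮` of circuits, then `𝒮` is a tropical basis of `M`. -/
theorem stmt3 {α : Type*} [Fintype α] (M : Matroid α) (𝒞 : Set (Set α))
    (h𝒞 : 𝒞 = {C | MatroidCircuit M C}) (𝒮 : Set (Set α)) (h𝒮 : 𝒮 ⊆ 𝒞)
    (hpaste : ∀ C ∈ 𝒞, PastingClosure 𝒮 C) :
    tropT 𝒮 = tropT 𝒞 :=
  Set.Subset.antisymm (fun _ hx C hC => (hpaste C hC).attainsMinTwice hx)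
    (fun _ hx C hC => hx C (h𝒮 hC))
end

section
/- Let 1 ≤ d < n, let U_{d,n} be the uniform matroid on [n] = {1, …, n} whose circuits are exactly the (d+1)-element subsets of [n], and fix an element i ∈ [n]. Then the family ℬ = {C ⊆ [n] : |C| = d+1 and i ∈ C} is a tropical basis of U_{d,n}, and it is inclusion-minimal: for every C* ∈ ℬ, the family ℬ \ {C*} is not a tropical basis of U_{d,n}. -/
/-- If every set obtained from `C` by exchanging one element for `i` attains its minimum twice,
then so does `C`. -/
theorem AttainsMinTwice.of_forall_exchange {α : Type*} {C : Set α} {i : α} {x : α → ℝ}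
    (hC : C.Finite) (hnt : C.Nontrivial) (hi : i ∉ C)
    (h : ∀ c ∈ C, AttainsMinTwice (insert i (C \ {c})) x) : AttainsMinTwice C x := by
  obtain ⟨a, ha, hmin⟩ := hC.exists_minimalFor x C hnt.nonempty
  have hle : ∀ k ∈ C, x a ≤ x k := fun k hk => (le_total (x a) (x k)).elim id (hmin hk)
  by_contra hnot
  have huniq : ∀ k ∈ C, k ≠ a → x a < x k := fun k hk hka =>
    lt_of_le_of_ne (hle k hk) fun he => hnot ⟨a, ha, k, hk, hka.symm, he, hle⟩
  obtain ⟨c, hc, hca⟩ := hnt.exists_ne a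
  have hia : x i = x a := by
    obtain ⟨p, hp, q, hq, hpq, hxpq, hpmin⟩ := h c hc
    have hpa := hpmin a (Or.inr ⟨ha, hca.symm⟩)
    have hpi := hpmin i (Or.inl rfl)
    rcases hp with rfl | ⟨hp, -⟩ <;> rcases hq with rfl | ⟨hq, -⟩ <;> grind
  obtain ⟨p, hp, q, hq, hpq, hxpq, hpmin⟩ := h a ha
  have hpi := hpmin i (Or.inl rfl)
  rcases hp with rfl | ⟨hp, hp'⟩ <;> rcases hq with rfl | ⟨hq, hq'⟩ <;> grind

/-- let `𝒞` be the circuit family of the uniform matroid `U_{d,n}` on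
`Fin n` (the `(d+1)`-element subsets), with `1 ≤ d < n`, and fix `i`. Then
`ℬ = {C : |C| = d+1, i ∈ C}` is a tropical basis, and it is inclusion-minimal:
removing any member destroys the tropical basis property. -/
theorem stmt5 (d n : ℕ) (hd : 1 ≤ d) (hdn : d < n) (i : Fin n)
    (𝒞 : Set (Set (Fin n))) (h𝒞 : 𝒞 = {C : Set (Fin n) | C.ncard = d + 1})
    (ℬ : Set (Set (Fin n))) (hℬ : ℬ = {C : Set (Fin n) | C.ncard = d + 1 ∧ i ∈ C}) :
    tropT ℬ = tropT 𝒞 ∧ ∀ C' ∈ ℬ, tropT (ℬ \ {C'}) ≠ tropT 𝒞 := by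
  subst h𝒞 hℬ
  refine ⟨Set.Subset.antisymm (fun x hx C hC => ?_) fun x hx C hC => hx C hC.1,
    fun C' hC' heq => ?_⟩
  · by_cases hi : i ∈ C
    · exact hx C ⟨hC, hi⟩
    have hC : C.ncard = d + 1 := hC
    refine .of_forall_exchange C.toFinite ?_ hi fun c hc => hx _ ⟨?_, Set.mem_insert _ _⟩
    · exact Set.one_lt_ncard_iff_nontrivial.1 (by omega)
    · rw [Set.ncard_exchange hi hc, hC]
  · classical
    obtain ⟨hcard, hiC'⟩ := hC'
    let x : Fin n → ℝ := fun j => if j ∈ C' ∧ j ≠ i then 1 else 0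
    have hx : x ∈ tropT ({C : Set (Fin n) | C.ncard = d + 1 ∧ i ∈ C} \ {C'}) := by
      rintro C ⟨⟨hC, hiC⟩, hne⟩
      have hsub : ¬ C ⊆ C' := fun hs =>
        hne (Set.eq_of_subset_of_ncard_le hs (by omega) C'.toFinite)
      obtain ⟨j, hj, hj'⟩ := Set.not_subset.1 hsub
      refine ⟨i, hiC, j, hj, fun hij => hj' (hij ▸ hiC'), by simp [x, hj'], fun k _ => ?_⟩
      simp only [x]
      split_ifs <;> simp_all
    rw [heq] at hx
    obtain ⟨p, hp, q, hq, hpq, hxpq, hmin⟩ := hx C' hcard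
    have hpi := hmin i hiC'
    have hp_eq : p = i := by
      by_contra hne
      simp [x, hp, hne] at hpi
      linarith
    subst hp_eq
    simp [x, hq, hpq.symm] at hxpq
end

section
/- Let E = {1, 2, 3, 4, 5, 6, 7} and let ℒ = {{1,2,4}, {1,3,7}, {1,5,6}, {2,3,5}, {2,6,7}, {3,4,6}, {4,5,7}} be the seven lines of the Fano plane. Let 𝒞 consist of the seven members of ℒ together with every 4-element subset of E that contains no member of ℒ (this is the circuit family of the Fano matroid). Then a subset ℬ ⊆ 𝒞 satisfies T(ℬ) = T(𝒞) if and only if ℒ ⊆ ℬ; in particular the seven lines form the unique minimal tropical basis of the Fano matroid. -/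
/-- The seven lines of the Fano plane on the seven points `0, …, 6` (relabelling the
points `1, …, 7` of the lines `124, 137, 156, 235, 267, 346, 457` as `0, …, 6`). -/
def fanoLines : Set (Set (Fin 7)) :=
  {{0, 1, 3}, {0, 2, 6}, {0, 4, 5}, {1, 2, 4}, {1, 5, 6}, {2, 3, 5}, {3, 4, 6}}

/-- The circuits of the Fano matroid: the seven lines together with the 4-element
subsets containing no line. -/
def fanoCircuits : Set (Set (Fin 7)) :=
  fanoLines ∪ {C : Set (Fin 7) | C.ncard = 4 ∧ ∀ L ∈ fanoLines, ¬ L ⊆ C}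

/-- The lines of the Fano plane as finite sets. -/
def fanoLineFinsets : Finset (Finset (Fin 7)) :=
  {{0, 1, 3}, {0, 2, 6}, {0, 4, 5}, {1, 2, 4}, {1, 5, 6}, {2, 3, 5}, {3, 4, 6}}

theorem mem_fanoLines_iff {C : Set (Fin 7)} :
    C ∈ fanoLines ↔ ∃ F ∈ fanoLineFinsets, (F : Set (Fin 7)) = C := by
  simp [fanoLines, fanoLineFinsets, eq_comm]

theorem exists_finset_of_mem_fanoCircuits {C : Set (Fin 7)} (hC : C ∈ fanoCircuits) :
    ∃ F : Finset (Fin 7), (F : Set (Fin 7)) = C ∧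
      (F ∈ fanoLineFinsets ∨ F.card = 4 ∧ ∀ L ∈ fanoLineFinsets, ¬ L ⊆ F) := by
  rcases hC with hC | ⟨hcard, hline⟩
  · obtain ⟨F, hF, rfl⟩ := mem_fanoLines_iff.1 hC
    exact ⟨F, rfl, Or.inl hF⟩
  · obtain ⟨F, rfl⟩ := C.toFinite.exists_finset_coe
    refine ⟨F, rfl, Or.inr ⟨by simpa using hcard, fun L hL hLF => ?_⟩⟩
    exact hline L (mem_fanoLines_iff.2 ⟨L, hL, rfl⟩) (by exact_mod_cast hLF)

/-- Every point `c` of a line-free quadruple `C` lies on a line `{c, a, d}` such that `a` is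
collinear with two points of `C`, where `d` and the latter two points belong to `C \ {c}`. -/
theorem exists_lines_of_lineFree_quadruple :
    ∀ C : Finset (Fin 7), C.card = 4 → (∀ L ∈ fanoLineFinsets, ¬ L ⊆ C) → ∀ c ∈ C,
      ∃ a, ∃ d ∈ C.erase c, {c, a, d} ∈ fanoLineFinsets ∧
        ∃ L ∈ fanoLineFinsets, a ∈ L ∧ L.erase a ⊆ C.erase c := by
  decide +kernel

theorem AttainsMinTwice.exists_ne_le {α : Type*} {C : Set α} {x : α → ℝ}
    (h : AttainsMinTwice C x) (c : α) : ∃ j ∈ C, j ≠ c ∧ ∀ k ∈ C, x j ≤ x k := by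
  obtain ⟨i, hi, j, hj, hij, hx, hmin⟩ := h
  by_cases hic : i = c
  · exact ⟨j, hj, fun hjc => hij (hic.trans hjc.symm), fun k hk => hx ▸ hmin k hk⟩
  · exact ⟨i, hi, hic, hmin⟩

theorem attainsMinTwice_of_forall_exists_ne_le {α : Type*} {C : Set α} {x : α → ℝ} {c : α}
    (hc : c ∈ C) (hmin : ∀ k ∈ C, x c ≤ x k) (h : ∃ j ∈ C, j ≠ c ∧ x j ≤ x c) :
    AttainsMinTwice C x := by
  obtain ⟨j, hj, hjc, hle⟩ := h
  exact ⟨c, hc, j, hj, hjc.symm, le_antisymm (hmin j hj) hle, hmin⟩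

theorem tropT_fanoLines_subset : tropT fanoLines ⊆ tropT fanoCircuits := by
  intro x hx C hC
  have hxF : ∀ F ∈ fanoLineFinsets, AttainsMinTwice (F : Set (Fin 7)) x :=
    fun F hF => hx F (mem_fanoLines_iff.2 ⟨F, hF, rfl⟩)
  obtain ⟨F, rfl, hF | ⟨hcard, hfree⟩⟩ := exists_finset_of_mem_fanoCircuits hC
  · exact hxF F hF
  obtain ⟨c, hc, hmin⟩ := F.exists_min_image x (Finset.card_pos.1 (by omega))
  refine attainsMinTwice_of_forall_exists_ne_le (c := c) (by simpa using hc)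
    (fun k hk => hmin k (by simpa using hk)) ?_
  by_contra! hlt
  obtain ⟨a, d, hd, hL, M, hM, haM, hMF⟩ :=
    exists_lines_of_lineFree_quadruple F hcard hfree c hc
  have hlt' : ∀ k ∈ F.erase c, x c < x k := fun k hk =>
    hlt k (by simpa using (Finset.mem_erase.1 hk).2) (Finset.mem_erase.1 hk).1
  obtain ⟨i, hi, hic, hile⟩ := (hxF _ hL).exists_ne_le c
  have hxd := hlt' d hd
  have hca : x a ≤ x c := by
    have hxi : x i ≤ x c := hile c (by simp)
    have hi' : i = c ∨ i = a ∨ i = d := by simpa using hi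
    rcases hi' with rfl | rfl | rfl
    · exact absurd rfl hic
    · exact hxi
    · exact absurd hxi (not_le.2 hxd)
  obtain ⟨j, hj, hja, hjle⟩ := (hxF M hM).exists_ne_le a
  have hxj := hlt' j (hMF (Finset.mem_erase.2 ⟨hja, by simpa using hj⟩))
  have hja' := hjle a (by simpa using haM)
  linarith

/-- Every line contains two points `b`, `c` such that each other line has at least two points
outside `{b, c}`. -/
theorem exists_points_of_mem_fanoLineFinsets :
    ∀ L ∈ fanoLineFinsets, ∃ a b c, L = {a, b, c} ∧ a ≠ b ∧ a ≠ c ∧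
      ∀ M ∈ fanoLineFinsets, M ≠ L → 1 < (M \ {b, c}).card := by
  decide +kernel

theorem attainsMinTwice_ite {α : Type*} [DecidableEq α] {F S : Finset α}
    (h : 1 < (F \ S).card) :
    AttainsMinTwice (F : Set α) (fun i => if i ∈ S then 1 else 0) := by
  obtain ⟨i, hi, j, hj, hij⟩ := Finset.one_lt_card.1 h
  rw [Finset.mem_sdiff] at hi hj
  refine ⟨i, by simpa using hi.1, j, by simpa using hj.1, hij, by simp [hi.2, hj.2], ?_⟩
  intro k _
  simp only [hi.2, if_false]
  split_ifs <;> norm_num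

theorem exists_mem_tropT_sdiff_line {L : Finset (Fin 7)} (hL : L ∈ fanoLineFinsets) :
    ∃ x ∈ tropT (fanoCircuits \ {(L : Set (Fin 7))}), ¬ AttainsMinTwice (L : Set (Fin 7)) x := by
  obtain ⟨a, b, c, rfl, hab, hac, hM⟩ := exists_points_of_mem_fanoLineFinsets L hL
  refine ⟨fun i => if i ∈ ({b, c} : Finset (Fin 7)) then 1 else 0, ?_, fun h => ?_⟩
  · rintro C ⟨hC, hne⟩
    obtain ⟨F, rfl, hF | ⟨hcard, -⟩⟩ := exists_finset_of_mem_fanoCircuits hC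
    · exact attainsMinTwice_ite (hM F hF fun h => hne (by rw [h]; rfl))
    · apply attainsMinTwice_ite
      have h₁ := Finset.le_card_sdiff ({b, c} : Finset (Fin 7)) F
      have h₂ := Finset.card_le_two (a := b) (b := c)
      omega
  · obtain ⟨j, hj, hja, hle⟩ := h.exists_ne_le a
    have hj' : j ∈ ({b, c} : Finset (Fin 7)) := by simpa [hja] using hj
    have := hle a (by simp)
    rw [if_pos hj', if_neg (by simp [hab, hac])] at this
    norm_num at this

/-- a subfamily `ℬ` of the circuits of the Fano matroid satisfies
`T(ℬ) = T(𝒞)` iff `ℬ` contains all seven lines; the lines form the unique minimal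
tropical basis. -/
theorem stmt6 (ℬ : Set (Set (Fin 7))) (hℬ : ℬ ⊆ fanoCircuits) :
    tropT ℬ = tropT fanoCircuits ↔ fanoLines ⊆ ℬ := by
  constructor
  · intro h C hC
    by_contra hCℬ
    obtain ⟨L, hL, rfl⟩ := mem_fanoLines_iff.1 hC
    obtain ⟨x, hx, hxL⟩ := exists_mem_tropT_sdiff_line hL
    have hsub : ℬ ⊆ fanoCircuits \ {(L : Set (Fin 7))} :=
      Set.subset_sdiff_singleton hℬ hCℬ
    have hxℬ : x ∈ tropT ℬ := tropT_anti hsub hx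
    rw [h] at hxℬ
    exact hxL (hxℬ _ (Or.inl hC))
  · intro h
    exact ((tropT_anti h).trans tropT_fanoLines_subset).antisymm (tropT_anti hℬ)
end

section
/- Let G be a finite simple graph and let x assign a real weight to each edge of G. If for every induced cycle of G the minimum edge weight on that cycle is attained by at least two distinct edges, then for every cycle of G the minimum edge weight on that cycle is attained by at least two distinct edges. -/
/-- `C` is the edge set of a cycle of the simple graph `G`. -/
def IsCycleEdgeSet {V : Type*} (G : SimpleGraph V) (C : Set (Sym2 V)) : Prop :=
  ∃ (u : V) (w : G.Walk u u), w.IsCycle ∧ C = {e | e ∈ w.edges}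

/-- `C` is the edge set of an induced (chordless) cycle of `G`: a cycle such that the
only edges of `G` between vertices of the cycle are the cycle edges themselves. -/
def IsInducedCycleEdgeSet {V : Type*} (G : SimpleGraph V) (C : Set (Sym2 V)) : Prop :=
  ∃ (u : V) (w : G.Walk u u), w.IsCycle ∧
    (∀ a b : V, a ∈ w.support → b ∈ w.support → G.Adj a b → s(a, b) ∈ w.edges) ∧
    C = {e | e ∈ w.edges}

namespace SimpleGraph.Walk

variable {V : Type*} {G : SimpleGraph V}

lemma two_le_length_of_notMem_edges {u v : V} {p : G.Walk u v} (huv : u ≠ v)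
    (h : s(u, v) ∉ p.edges) : 2 ≤ p.length := by
  cases p with
  | nil => exact absurd rfl huv
  | cons _ q =>
    cases q with
    | nil => simp at h
    | cons _ r => simp

/-- Two vertices of a walk cut it into three pieces. -/
lemma exists_eq_append_append {u v a b : V} (p : G.Walk u v) (ha : a ∈ p.support)
    (hb : b ∈ p.support) :
    (∃ (q : G.Walk u a) (r : G.Walk a b) (s : G.Walk b v), p = q.append (r.append s)) ∨
      ∃ (q : G.Walk u b) (r : G.Walk b a) (s : G.Walk a v), p = q.append (r.append s) := by
  obtain ⟨q, r, rfl⟩ := mem_support_iff_exists_append.1 ha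
  rcases mem_support_append_iff _ _ |>.1 hb with hb | hb
  · obtain ⟨q₁, q₂, rfl⟩ := mem_support_iff_exists_append.1 hb
    exact .inr ⟨q₁, q₂, r, (append_assoc ..).symm⟩
  · obtain ⟨r₁, r₂, rfl⟩ := mem_support_iff_exists_append.1 hb
    exact .inl ⟨q, r₁, r₂, rfl⟩

/-- An edge on a cycle is joined at its ends by a path using only the other edges of the cycle. -/
lemma IsCycle.exists_isPath_edges_subset {c u v : V} {w : G.Walk c c} (hw : w.IsCycle)
    (he : s(u, v) ∈ w.edges) :
    ∃ p : G.Walk u v, p.IsPath ∧ ∀ e ∈ p.edges, e ∈ w.edges ∧ e ≠ s(u, v) := by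
  classical
  set H := fromEdgeSet {e | e ∈ w.edges} with hH
  have hmem : ∀ e ∈ w.edges, e ∈ H.edgeSet := fun e h => by
    rw [hH, edgeSet_fromEdgeSet]
    exact ⟨h, G.not_isDiag_of_mem_edgeSet (w.edges_subset_edgeSet h)⟩
  have hreach : (H \ fromEdgeSet {s(u, v)}).Reachable u v :=
    (adj_and_reachable_delete_edges_iff_exists_cycle.2
      ⟨c, w.transfer H hmem, hw.transfer hmem, by simpa using he⟩).2
  obtain ⟨q, hq⟩ := hreach.exists_isPath
  have hq' : ∀ e ∈ q.edges, e ∈ w.edges ∧ e ≠ s(u, v) := fun e h => by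
    have := q.edges_subset_edgeSet h
    induction e
    simp [hH] at this
    grind
  exact ⟨q.transfer G fun e h => w.edges_subset_edgeSet (hq' e h).1, hq.transfer _,
    by simpa using hq'⟩

end SimpleGraph.Walk

open SimpleGraph in
/-- If every induced cycle attains its minimum twice, then no edge is strictly lighter than all
the edges of a path joining its ends. -/
lemma exists_mem_edges_le_of_isPath {V : Type*} {G : SimpleGraph V} {x : Sym2 V → ℝ}
    (hind : ∀ C : Set (Sym2 V), IsInducedCycleEdgeSet G C → AttainsMinTwice C x) (n : ℕ) :
    ∀ {u v : V} (p : G.Walk u v), p.length = n → p.IsPath → G.Adj u v → s(u, v) ∉ p.edges →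
      ∃ e ∈ p.edges, x e ≤ x s(u, v) := by
  induction n using Nat.strong_induction_on with
  | _ n ih =>
  intro u v p hn hp huv hnot
  by_contra! hlt
  have hcyc : (Walk.cons huv.symm p).IsCycle :=
    (Walk.cons_isCycle_iff p huv.symm).2 ⟨hp, by rwa [Sym2.eq_swap]⟩
  by_cases hchord : ∀ a b : V, a ∈ p.support → b ∈ p.support → G.Adj a b →
      s(a, b) ∈ (Walk.cons huv.symm p).edges
  · obtain ⟨i, hi, j, hj, hij, hxij, hmin⟩ := hind _ ⟨v, _, hcyc, fun a b ha hb =>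
      hchord a b (by grind [Walk.support_cons, p.end_mem_support])
        (by grind [Walk.support_cons, p.end_mem_support]), rfl⟩
    have hmin' := hmin s(v, u) (by simp)
    simp only [Walk.edges_cons, List.mem_cons, Set.mem_ofPred_eq] at hi hj
    rw [Sym2.eq_swap] at hmin'
    grind
  · push Not at hchord
    have key : ∀ {a b : V} (q : G.Walk u a) (r : G.Walk a b) (s : G.Walk b v),
        p = q.append (r.append s) → G.Adj a b → s(a, b) ∉ p.edges → s(a, b) ≠ s(u, v) →
        False := by
      rintro a b q r s rfl hab habp hne
      have hr := r.two_le_length_of_notMem_edges hab.ne (by simp_all)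
      simp only [Walk.length_append] at hn
      have hqs : 0 < q.length + s.length := by
        by_contra! h0
        have hq : u = a := Walk.eq_of_length_eq_zero (p := q) (by omega)
        have hs : b = v := Walk.eq_of_length_eq_zero (p := s) (by omega)
        exact hne (by rw [hq, hs])
      obtain ⟨e, he, hle⟩ := ih _ (by omega) r rfl hp.of_append_right.of_append_left hab
        (by simp_all)
      have hab_lt : x s(u, v) < x s(a, b) := (hlt e (by simp [he])).trans_le hle
      have hp' : (q.append (Walk.cons hab s)).IsPath := by
        rw [Walk.isPath_def] at hp ⊢
        refine hp.sublist ?_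
        simp only [Walk.support_append, Walk.support_cons, List.tail_cons]
        refine List.Sublist.append_left ?_ _
        cases r with
        | nil => exact absurd rfl hab.ne
        | cons h r =>
          simp only [Walk.support_cons, List.tail_cons, List.cons_append]
          rw [← Walk.support_append, Walk.support_append_eq_support_dropLast_append]
          exact List.sublist_append_right _ _
      obtain ⟨e', he', hle'⟩ := ih _ (by simp; omega) (q.append (Walk.cons hab s)) rfl hp' huv
        (by simp_all [eq_comm])
      simp only [Walk.edges_append, Walk.edges_cons, List.mem_append, List.mem_cons] at he' hlt
      grind
    obtain ⟨a, b, ha, hb, hab, habp⟩ := hchord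
    simp only [Walk.edges_cons, List.mem_cons, not_or] at habp
    rw [Sym2.eq_swap (a := v)] at habp
    rcases p.exists_eq_append_append ha hb with ⟨q, r, s, h⟩ | ⟨q, r, s, h⟩
    · exact key q r s h hab habp.2 habp.1
    · rw [Sym2.eq_swap (a := a)] at habp
      exact key q r s h hab.symm habp.2 habp.1

/-- if an edge-weight vector of a finite simple graph attains its minimum
at least twice on every induced cycle, then it attains its minimum at least twice on
every cycle. -/
theorem stmt7 {V : Type*} [Fintype V] (G : SimpleGraph V) (x : Sym2 V → ℝ)
    (hind : ∀ C : Set (Sym2 V), IsInducedCycleEdgeSet G C → AttainsMinTwice C x) :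
    ∀ C : Set (Sym2 V), IsCycleEdgeSet G C → AttainsMinTwice C x := by
  rintro C ⟨c, w, hw, rfl⟩
  have hne : {e | e ∈ w.edges}.Nonempty :=
    List.exists_mem_of_ne_nil _ (by simpa [SimpleGraph.Walk.edges_eq_nil] using hw.not_nil)
  obtain ⟨e, he, hmin⟩ := Set.exists_min_image _ x (List.finite_toSet w.edges) hne
  induction e with
  | _ u v =>
  obtain ⟨p, hp, hpw⟩ := hw.exists_isPath_edges_subset he
  obtain ⟨f, hf, hle⟩ := exists_mem_edges_le_of_isPath hind _ p rfl hp
    (w.edges_subset_edgeSet he) fun h => (hpw _ h).2 rfl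
  exact ⟨_, he, f, (hpw f hf).1, (hpw f hf).2.symm, (hmin f (hpw f hf).1).antisymm hle, hmin⟩
end

section
/- Let G be a finite simple graph (no loops, no parallel edges), and let 𝒞 be the family of edge sets of cycles of G, which is the circuit family of the graphic matroid of G. Then a subset ℬ ⊆ 𝒞 satisfies T(ℬ) = T(𝒞) if and only if ℬ contains the edge set of every induced cycle of G; in particular the collection of induced cycles is the unique minimal tropical basis of the graphic matroid of G. -/
/-- Elimination of a common element `f` of two sets preserves the attainment of the minimum. -/
theorem AttainsMinTwice.union_of_insert {α : Type*} {P Q : Set α} {f : α} {x : α → ℝ}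
    (hPQ : Disjoint P Q) (hP : AttainsMinTwice (insert f P) x)
    (hQ : AttainsMinTwice (insert f Q) x) : AttainsMinTwice (P ∪ Q) x := by
  have key : ∀ R : Set α, AttainsMinTwice (insert f R) x →
      (∃ i ∈ R, x i = x f ∧ ∀ k ∈ R, x i ≤ x k) ∨ (AttainsMinTwice R x ∧ ∃ i ∈ R, x i ≤ x f ∧
        ∀ k ∈ R, x i ≤ x k) := by
    rintro R ⟨i, hi, j, hj, hij, hx, hmin⟩
    have hf := hmin f (Set.mem_insert f R)
    have hR : ∀ k ∈ R, x i ≤ x k := fun k hk => hmin k (Set.mem_insert_of_mem f hk)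
    rcases hi with rfl | hi
    · rcases hj with rfl | hj
      · exact absurd rfl hij
      · exact Or.inl ⟨j, hj, hx.symm, fun k hk => hx ▸ hR k hk⟩
    · rcases hj with rfl | hj
      · exact Or.inl ⟨i, hi, hx, hR⟩
      · exact Or.inr ⟨⟨i, hi, j, hj, hij, hx, hR⟩, i, hi, hf, hR⟩
  have extend : ∀ R S : Set α, AttainsMinTwice R x → ∀ i ∈ R, (∀ k ∈ S, x i ≤ x k) →
      AttainsMinTwice (R ∪ S) x := by
    rintro R S ⟨a, ha, b, hb, hab, hx, hmin⟩ i hi hS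
    exact ⟨a, Or.inl ha, b, Or.inl hb, hab, hx, fun k hk =>
      hk.elim (hmin k) fun hk => (hmin i hi).trans (hS k hk)⟩
  rcases key P hP with ⟨i, hi, hif, hiP⟩ | ⟨hP, i, hi, hif, hiP⟩ <;>
    rcases key Q hQ with ⟨j, hj, hjf, hjQ⟩ | ⟨hQ, j, hj, hjf, hjQ⟩
  · refine ⟨i, Or.inl hi, j, Or.inr hj, hPQ.ne_of_mem hi hj, hif.trans hjf.symm, ?_⟩
    exact fun k hk => hk.elim (hiP k) fun hk => hif.trans hjf.symm ▸ hjQ k hk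
  · rw [Set.union_comm]
    exact extend Q P hQ j hj fun k hk => hjf.trans (hif ▸ hiP k hk)
  · exact extend P Q hP i hi fun k hk => hif.trans (hjf ▸ hjQ k hk)
  · rcases le_total (x i) (x j) with h | h
    · exact extend P Q hP i hi fun k hk => h.trans (hjQ k hk)
    · rw [Set.union_comm]
      exact extend Q P hQ j hj fun k hk => h.trans (hiP k hk)

namespace SimpleGraph.Walk

variable {V : Type*} {G : SimpleGraph V}

theorem one_lt_length_of_notMem_edges {a b : V} (p : G.Walk a b) (hab : a ≠ b)
    (h : s(a, b) ∉ p.edges) : 1 < p.length := by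
  cases p with
  | nil => exact absurd rfl hab
  | cons _ q =>
    cases q with
    | nil => simp at h
    | cons _ _ => simp

/-- Every edge of a cycle is followed by another one at each of its endpoints. -/
theorem IsCycle.exists_ne_mem_edges {u a b : V} {w : G.Walk u u} (hw : w.IsCycle)
    (h : s(a, b) ∈ w.edges) : ∃ c, c ≠ b ∧ s(a, c) ∈ w.edges := by
  have hcard := hw.ncard_neighborSet_toSubgraph_eq_two (w.fst_mem_support_of_mem_edges h)
  obtain ⟨c, hc, hne⟩ := Set.exists_ne_of_one_lt_ncard (hcard ▸ one_lt_two) b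
  exact ⟨c, hne, adj_toSubgraph_iff_mem_edges.1 hc⟩

/-- A cycle whose edges all lie on another cycle passes through all edges of the latter. -/
theorem IsCycle.edges_subset_of_edges_subset {u v : V} {w : G.Walk u u} {c : G.Walk v v}
    (hw : w.IsCycle) (hc : c.IsCycle) (h : c.edges ⊆ w.edges) : w.edges ⊆ c.edges := by
  classical
  have step : ∀ a b : V, a ∈ c.support → s(a, b) ∈ w.edges → s(a, b) ∈ c.edges := by
    intro a b ha hab
    have hsub : c.toSubgraph.neighborSet a ⊆ w.toSubgraph.neighborSet a := fun d hd =>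
      adj_toSubgraph_iff_mem_edges.2 (h (adj_toSubgraph_iff_mem_edges.1 hd))
    have heq := Set.eq_of_subset_of_ncard_le hsub (by
      rw [hc.ncard_neighborSet_toSubgraph_eq_two ha,
        hw.ncard_neighborSet_toSubgraph_eq_two (w.fst_mem_support_of_mem_edges hab)])
      w.finite_neighborSet_toSubgraph
    have hb : b ∈ w.toSubgraph.neighborSet a := adj_toSubgraph_iff_mem_edges.2 hab
    rw [← heq] at hb
    exact adj_toSubgraph_iff_mem_edges.1 hb
  have walk : ∀ (a b : V) (p : G.Walk a b), a ∈ c.support → p.edges ⊆ w.edges →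
      p.edges ⊆ c.edges := by
    intro a b p
    induction p with
    | nil => simp
    | cons hadj q ih =>
      intro ha hp
      rw [edges_cons, List.cons_subset] at hp ⊢
      have he := step _ _ ha hp.1
      exact ⟨he, ih (c.snd_mem_support_of_mem_edges he) hp.2⟩
  have hv : v ∈ w.support :=
    w.fst_mem_support_of_mem_edges (h (c.mk_start_snd_mem_edges hc.not_nil))
  have hrot := w.rotate_edges v hv
  exact fun e he => walk v v (w.rotate v hv) c.start_mem_support
    (fun e he => hrot.mem_iff.1 he) (hrot.mem_iff.2 he)

/-- A chord splits a cycle into two shorter cycles meeting only in the chord. -/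
theorem IsCycle.exists_split {u a b : V} {w : G.Walk u u} (hw : w.IsCycle)
    (ha : a ∈ w.support) (hb : b ∈ w.support) (hab : G.Adj a b) (he : s(a, b) ∉ w.edges) :
    ∃ (p : G.Walk b b) (q : G.Walk a a) (P Q : Set (Sym2 V)), p.IsCycle ∧ q.IsCycle ∧
      p.length < w.length ∧ q.length < w.length ∧ Disjoint P Q ∧
      {e | e ∈ p.edges} = insert s(a, b) P ∧ {e | e ∈ q.edges} = insert s(a, b) Q ∧
      {e | e ∈ w.edges} = P ∪ Q := by
  classical
  have hrot := w.rotate_edges a ha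
  have hcyc : (w.rotate a ha).IsCycle := (isCycle_rotate ha).2 hw
  have hlen := w.length_rotate a ha
  have hb' : b ∈ (w.rotate a ha).support := (w.mem_support_rotate_iff a ha).2 hb
  rw [← hrot.mem_iff] at he
  have hset : {e | e ∈ w.edges} = {e | e ∈ (w.rotate a ha).edges} :=
    Set.ext fun e => hrot.mem_iff.symm
  obtain ⟨p, q, hpq⟩ := mem_support_iff_exists_append.1 hb'
  rw [hpq] at hcyc hlen he hset
  rw [edges_append, List.mem_append, not_or] at he
  have hp := p.one_lt_length_of_notMem_edges hab.ne he.1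
  have hq := q.one_lt_length_of_notMem_edges hab.ne' (Sym2.eq_swap ▸ he.2)
  rw [length_append] at hlen
  have hnodup := hcyc.edges_nodup
  rw [edges_append, List.nodup_append] at hnodup
  refine ⟨cons hab.symm p, cons hab q, {e | e ∈ p.edges}, {e | e ∈ q.edges}, ?_, ?_, ?_, ?_,
    ?_, ?_, ?_, ?_⟩
  · refine (cons_isCycle_iff _ _).2 ⟨hcyc.isPath_of_append_left ?_, Sym2.eq_swap ▸ he.1⟩
    exact fun h => by have := length_eq_zero_iff.2 h; omega
  · refine (cons_isCycle_iff _ _).2 ⟨hcyc.isPath_of_append_right ?_, he.2⟩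
    exact fun h => by have := length_eq_zero_iff.2 h; omega
  · rw [length_cons]; omega
  · rw [length_cons]; omega
  · exact Set.disjoint_left.2 fun e h₁ h₂ => hnodup.2.2 e h₁ e h₂ rfl
  · ext e; simp [Sym2.eq_swap (a := b)]
  · ext e; simp
  · rw [hset]; ext e; simp

end SimpleGraph.Walk

theorem attainsMinTwice_of_forall_induced {V : Type*} {G : SimpleGraph V} {x : Sym2 V → ℝ}
    (hx : ∀ C : Set (Sym2 V), IsInducedCycleEdgeSet G C → AttainsMinTwice C x) (n : ℕ) :
    ∀ (u : V) (w : G.Walk u u), w.IsCycle → w.length = n →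
      AttainsMinTwice {e | e ∈ w.edges} x := by
  induction n using Nat.strong_induction_on with
  | _ n ih =>
    rintro u w hw rfl
    by_cases hind : ∀ a b : V, a ∈ w.support → b ∈ w.support → G.Adj a b → s(a, b) ∈ w.edges
    · exact hx _ ⟨u, w, hw, hind, rfl⟩
    · push Not at hind
      obtain ⟨a, b, ha, hb, hab, he⟩ := hind
      obtain ⟨p, q, P, Q, hp, hq, hpl, hql, hd, hpe, hqe, hwe⟩ := hw.exists_split ha hb hab he
      rw [hwe]
      exact .union_of_insert hd (hpe ▸ ih _ hpl _ p hp rfl) (hqe ▸ ih _ hql _ q hq rfl)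

/-- A cycle other than an induced cycle `w` has at least two edges outside `w`. -/
theorem exists_ne_notMem_of_induced {V : Type*} {G : SimpleGraph V} {u v : V}
    {w : G.Walk u u} {c : G.Walk v v} (hw : w.IsCycle) (hc : c.IsCycle)
    (hind : ∀ a b : V, a ∈ w.support → b ∈ w.support → G.Adj a b → s(a, b) ∈ w.edges)
    (hne : {e | e ∈ c.edges} ≠ {e | e ∈ w.edges}) :
    ∃ e ∈ c.edges, ∃ f ∈ c.edges, e ≠ f ∧ e ∉ w.edges ∧ f ∉ w.edges := by
  have hsub : ¬ c.edges ⊆ w.edges := fun h =>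
    hne (Set.Subset.antisymm h (hw.edges_subset_of_edges_subset hc h))
  obtain ⟨e, he, hew⟩ : ∃ e ∈ c.edges, e ∉ w.edges := by
    simpa [List.subset_def] using hsub
  by_contra! hcon
  have other : ∀ f ∈ c.edges, f ≠ e → f ∈ w.edges := fun f hf hfe => hcon e he f hf hfe.symm hew
  have mem : ∀ a b : V, s(a, b) = e → a ∈ w.support := by
    rintro a b rfl
    obtain ⟨d, hd, hmem⟩ := hc.exists_ne_mem_edges he
    exact w.fst_mem_support_of_mem_edges (other _ hmem fun h => hd (Sym2.congr_right.1 h))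
  induction e with
  | _ a b =>
    exact hew (hind a b (mem a b rfl) (mem b a Sym2.eq_swap) (c.adj_of_mem_edges he))

/-- for the graphic matroid of a finite simple graph `G`, whose circuits
`𝒞` are the edge sets of cycles of `G`, a subfamily `ℬ ⊆ 𝒞` satisfies `T(ℬ) = T(𝒞)`
iff `ℬ` contains every induced cycle; the induced cycles form the unique minimal
tropical basis. -/
theorem stmt8 {V : Type*} [Fintype V] (G : SimpleGraph V) (𝒞 : Set (Set (Sym2 V)))
    (h𝒞 : 𝒞 = {C | IsCycleEdgeSet G C}) (ℬ : Set (Set (Sym2 V))) (hℬ : ℬ ⊆ 𝒞) :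
    tropT ℬ = tropT 𝒞 ↔ ∀ C : Set (Sym2 V), IsInducedCycleEdgeSet G C → C ∈ ℬ := by
  subst h𝒞
  constructor
  · rintro hT C₀ ⟨u, w, hw, hind, rfl⟩
    by_contra hnot
    classical
    set e₀ : Sym2 V := s(u, w.snd)
    have he₀ : e₀ ∈ w.edges := w.mk_start_snd_mem_edges hw.not_nil
    let x : Sym2 V → ℝ := fun f => if f ∈ w.edges then if f = e₀ then 1 else 2 else 0
    have hx₀ : ∀ f, 0 ≤ x f := by
      intro f
      dsimp only [x]
      split_ifs <;> norm_num
    have hxB : x ∈ tropT ℬ := by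
      intro C hC
      obtain ⟨v, c, hc, rfl⟩ := hℬ hC
      obtain ⟨e, he, f, hf, hef, hew, hfw⟩ := exists_ne_notMem_of_induced hw hc hind
        fun h => hnot (h ▸ hC)
      have hxe : x e = 0 := if_neg hew
      have hxf : x f = 0 := if_neg hfw
      exact ⟨e, he, f, hf, hef, hxe.trans hxf.symm, fun k _ => hxe ▸ hx₀ k⟩
    rw [hT] at hxB
    obtain ⟨i, hi, j, hj, hij, hxij, hmin⟩ := hxB _ ⟨u, w, hw, rfl⟩
    have hone : ∀ f ∈ w.edges, x f ≤ x e₀ → f = e₀ := by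
      intro f hf hle
      by_contra hne
      simp only [x, if_pos hf, if_neg hne, if_pos he₀, if_true] at hle
      norm_num at hle
    exact hij ((hone i hi (hmin e₀ he₀)).trans (hone j hj (hxij ▸ hmin e₀ he₀)).symm)
  · intro h
    refine Set.Subset.antisymm (fun x hx C hC => ?_) fun x hx C hC => hx C (hℬ hC)
    obtain ⟨u, w, hw, rfl⟩ := hC
    exact attainsMinTwice_of_forall_induced (fun C hC => hx C (h C hC)) _ u w hw rfl
end

section
/- Let G be a finite simple graph and let C be the edge set of an induced cycle of G. Then there exists an edge-weight vector x : E(G) → ℝ whose minimum over C is attained by exactly one edge of C, while for every cycle of G other than C the minimum of x over that cycle is attained by at least two distinct edges. Consequently, every tropical basis of the graphic matroid of G must contain C. -/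
/-- The minimum of `x` over `C` is attained by exactly one element of `C`. -/
def AttainsMinUniquely {α : Type*} (C : Set α) (x : α → ℝ) : Prop :=
  ∃ e ∈ C, (∀ f ∈ C, x e ≤ x f) ∧ ∀ f ∈ C, x f = x e → f = e

/-- A vertex set containing the start of a walk and closed along its edges contains its support. -/
theorem SimpleGraph.Walk.support_subset_of_closed {V : Type*} {G : SimpleGraph V} {S : Set V}
    {a b : V} (p : G.Walk a b) (ha : a ∈ S)
    (h : ∀ x ∈ S, ∀ y, s(x, y) ∈ p.edges → y ∈ S) : ∀ x ∈ p.support, x ∈ S := by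
  induction p with
  | nil => simpa using ha
  | cons hadj q ih =>
    intro x hx
    rcases List.mem_cons.1 (Walk.support_cons hadj q ▸ hx) with rfl | hx
    · exact ha
    · exact ih (h _ ha _ (by simp)) (fun y hy z hz => h y hy z (by simp [hz])) x hx

/-- A vertex of a cycle lies on an edge of the cycle other than a given one. -/
theorem SimpleGraph.Walk.IsCycle.exists_mem_edges_ne {V : Type*} {G : SimpleGraph V} {u : V}
    {w : G.Walk u u} (hw : w.IsCycle) {a : V} (ha : a ∈ w.support) (b : V) :
    ∃ c, s(a, c) ∈ w.edges ∧ c ≠ b := by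
  obtain ⟨c, hc, hcb⟩ := Set.exists_ne_of_one_lt_ncard
    (by rw [hw.ncard_neighborSet_toSubgraph_eq_two ha]; norm_num :
      1 < (w.toSubgraph.neighborSet a).ncard) b
  exact ⟨c, w.adj_toSubgraph_iff_mem_edges.1 hc, hcb⟩

/-- A cycle whose edges all lie on another cycle has the same edges as that cycle. -/
theorem SimpleGraph.Walk.IsCycle.edges_subset_of_edges_subset_s9 {V : Type*} {G : SimpleGraph V}
    {u v : V} {w : G.Walk u u} {w' : G.Walk v v} (hw : w.IsCycle) (hw' : w'.IsCycle)
    (h : w'.edges ⊆ w.edges) : w.edges ⊆ w'.edges := by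
  classical
  have supp : ∀ a ∈ w'.support, a ∈ w.support := fun a ha => by
    obtain ⟨c, hc, -⟩ := hw'.exists_mem_edges_ne ha a
    exact w.fst_mem_support_of_mem_edges (h hc)
  have key : ∀ a ∈ w'.support, ∀ b, s(a, b) ∈ w.edges → s(a, b) ∈ w'.edges := by
    intro a ha b hb
    have h2 := hw.ncard_neighborSet_toSubgraph_eq_two (supp a ha)
    have heq : w'.toSubgraph.neighborSet a = w.toSubgraph.neighborSet a :=
      Set.eq_of_subset_of_ncard_le
        (fun c hc => w.adj_toSubgraph_iff_mem_edges.2 (h (w'.adj_toSubgraph_iff_mem_edges.1 hc)))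
        (by rw [h2, hw'.ncard_neighborSet_toSubgraph_eq_two ha])
        (Set.finite_of_ncard_ne_zero (by rw [h2]; norm_num))
    have hb' : b ∈ w.toSubgraph.neighborSet a := w.adj_toSubgraph_iff_mem_edges.2 hb
    rw [← heq] at hb'
    exact w'.adj_toSubgraph_iff_mem_edges.1 hb'
  have hv : v ∈ w.support := supp v w'.start_mem_support
  have hrot : ∀ e, e ∈ (w.rotate v hv).edges ↔ e ∈ w.edges := fun e =>
    (w.rotate_edges v hv).mem_iff
  have hsub := (w.rotate v hv).support_subset_of_closed (S := {a | a ∈ w'.support})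
    w'.start_mem_support fun a ha b hb =>
      w'.snd_mem_support_of_mem_edges (key a ha b ((hrot _).1 hb))
  intro e he
  induction e with
  | _ a b =>
    exact key a (hsub a (Walk.fst_mem_support_of_mem_edges _ ((hrot _).2 he))) b he

/-- A cycle with different edges from an induced cycle has two edges off the induced cycle. -/
theorem SimpleGraph.Walk.IsCycle.exists_two_edges_notMem_of_induced {V : Type*}
    {G : SimpleGraph V} {u v : V} {w : G.Walk u u} {w' : G.Walk v v} (hw : w.IsCycle)
    (hind : ∀ a b : V, a ∈ w.support → b ∈ w.support → G.Adj a b → s(a, b) ∈ w.edges)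
    (hw' : w'.IsCycle) (hne : {e | e ∈ w'.edges} ≠ {e | e ∈ w.edges}) :
    ∃ e ∈ w'.edges, ∃ f ∈ w'.edges, e ≠ f ∧ e ∉ w.edges ∧ f ∉ w.edges := by
  by_contra! hcon
  have hsub : w'.edges ⊆ w.edges := by
    intro e he
    by_contra hew
    have huniq : ∀ f ∈ w'.edges, f ≠ e → f ∈ w.edges := fun f hf hfe => by
      by_contra hfw
      exact hfw (hcon e he f hf hfe.symm hew)
    have hend : ∀ a b, e = s(a, b) → a ∈ w.support := by
      rintro a b rfl
      obtain ⟨c, hc, hcb⟩ := hw'.exists_mem_edges_ne (w'.fst_mem_support_of_mem_edges he) b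
      exact w.fst_mem_support_of_mem_edges
        (huniq _ hc fun heq => hcb (Sym2.congr_right.1 heq))
    induction e with
    | _ a b =>
      exact hew (hind a b (hend a b rfl) (hend b a Sym2.eq_swap) (w'.adj_of_mem_edges he))
  exact hne (Set.Subset.antisymm hsub (hw.edges_subset_of_edges_subset_s9 hw' hsub))

/-- A minimum attained twice is not attained uniquely. -/
theorem AttainsMinUniquely.not_attainsMinTwice {α : Type*} {C : Set α} {x : α → ℝ}
    (h : AttainsMinUniquely C x) : ¬ AttainsMinTwice C x := by
  obtain ⟨e, he, hmin, huniq⟩ := h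
  rintro ⟨i, hi, j, hj, hij, hxij, hmin'⟩
  have hxi : x i = x e := le_antisymm (hmin' e he) (hmin i hi)
  exact hij ((huniq i hi hxi).trans (huniq j hj (hxij ▸ hxi)).symm)

/-- for an induced cycle `C` of a finite simple graph `G` there is an
edge-weight vector attaining its minimum on `C` exactly once while attaining its
minimum at least twice on every other cycle; consequently every tropical basis of the
graphic matroid of `G` contains `C`. -/
theorem stmt9 {V : Type*} [Fintype V] (G : SimpleGraph V) (C : Set (Sym2 V))
    (hC : IsInducedCycleEdgeSet G C) :
    (∃ x : Sym2 V → ℝ, AttainsMinUniquely C x ∧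
      ∀ C' : Set (Sym2 V), IsCycleEdgeSet G C' → C' ≠ C → AttainsMinTwice C' x) ∧
    ∀ ℬ : Set (Set (Sym2 V)), ℬ ⊆ {D | IsCycleEdgeSet G D} →
      tropT ℬ = tropT {D | IsCycleEdgeSet G D} → C ∈ ℬ := by
  classical
  obtain ⟨u, w, hw, hind, rfl⟩ := hC
  have hex : ∃ x : Sym2 V → ℝ, AttainsMinUniquely {e | e ∈ w.edges} x ∧
      ∀ C' : Set (Sym2 V), IsCycleEdgeSet G C' → C' ≠ {e | e ∈ w.edges} →
        AttainsMinTwice C' x := by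
    obtain ⟨c, hc, -⟩ := hw.exists_mem_edges_ne w.start_mem_support u
    refine ⟨fun f => if f = s(u, c) then 1 else if f ∈ w.edges then 2 else 0,
      ⟨s(u, c), hc, fun f hf => ?_, fun f hf hfe => ?_⟩, ?_⟩
    · have hf' : f ∈ w.edges := hf
      simp only [hf', if_true]
      split_ifs <;> norm_num
    · have hf' : f ∈ w.edges := hf
      by_contra hne
      simp [hf', hne] at hfe
    · rintro C' ⟨v, w', hw', rfl⟩ hne
      obtain ⟨e, he, f, hf, hef, hew, hfw⟩ :=
        hw.exists_two_edges_notMem_of_induced hind hw' hne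
      have he0 : e ≠ s(u, c) := fun h => hew (h ▸ hc)
      have hf0 : f ≠ s(u, c) := fun h => hfw (h ▸ hc)
      refine ⟨e, he, f, hf, hef, by simp [he0, hf0, hew, hfw], fun k _ => ?_⟩
      simp only [he0, hew, if_false]
      split_ifs <;> norm_num
  refine ⟨hex, fun ℬ hℬ hT => ?_⟩
  obtain ⟨x, hx, hx'⟩ := hex
  by_contra hmem
  have hxT : x ∈ tropT ℬ := fun D hD => hx' D (hℬ hD) fun h => hmem (h ▸ hD)
  rw [hT] at hxT
  exact hx.not_attainsMinTwice (hxT _ ⟨u, w, hw, rfl⟩)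
end

section
/- Let G be a finite connected 3-edge-connected simple graph, and let 𝒞 be the family of inclusion-minimal edge cuts of G, which is the circuit family of the cographic matroid of G. Let 𝒮 ⊆ 𝒞 be the family of minimal edge cuts C such that deleting C from G leaves exactly two connected components, each of which is 2-edge-connected (connected and bridgeless). Then a subset ℬ ⊆ 𝒞 satisfies T(ℬ) = T(𝒞) if and only if 𝒮 ⊆ ℬ; in particular 𝒮 is the unique minimal tropical basis of the cographic matroid of G. -/
/-- An edge cut of `G`: a set of edges whose deletion disconnects `G`. -/
def IsEdgeCut {V : Type*} (G : SimpleGraph V) (D : Set (Sym2 V)) : Prop :=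
  D ⊆ G.edgeSet ∧ ¬ (G.deleteEdges D).Connected

/-- A minimal edge cut of `G` (a circuit of the cographic matroid of `G`). -/
def IsMinimalEdgeCut {V : Type*} (G : SimpleGraph V) (D : Set (Sym2 V)) : Prop :=
  Minimal (IsEdgeCut G) D

/-- A graph is 2-edge-connected if it is connected and has no bridge. -/
def TwoEdgeConnected {V : Type*} (G : SimpleGraph V) : Prop :=
  G.Connected ∧ ∀ e : Sym2 V, ¬ G.IsBridge e

/-- A graph is 3-edge-connected if it is connected and stays connected after deleting
any at most 2 edges. -/
def ThreeEdgeConnected {V : Type*} (G : SimpleGraph V) : Prop :=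
  G.Connected ∧ ∀ D : Set (Sym2 V), D.ncard ≤ 2 → (G.deleteEdges D).Connected

/-- A minimal edge cut whose deletion splits `G` into exactly two connected components,
each of which induces a 2-edge-connected graph. -/
def IsGoodCut {V : Type*} (G : SimpleGraph V) (C : Set (Sym2 V)) : Prop :=
  IsMinimalEdgeCut G C ∧
  ∃ c₁ c₂ : (G.deleteEdges C).ConnectedComponent, c₁ ≠ c₂ ∧
    (∀ c : (G.deleteEdges C).ConnectedComponent, c = c₁ ∨ c = c₂) ∧
    TwoEdgeConnected ((G.deleteEdges C).induce c₁.supp) ∧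
    TwoEdgeConnected ((G.deleteEdges C).induce c₂.supp)

namespace SimpleGraph

variable {V : Type*}

lemma Reachable.induct {G : SimpleGraph V} {P : V → Prop} {a b : V} (h : G.Reachable a b)
    (ha : P a) (step : ∀ x y, P x → G.Adj x y → P y) : P b := by
  rw [reachable_iff_reflTransGen] at h
  induction h with
  | refl => exact ha
  | tail _ hxy ih => exact step _ _ ih hxy

/-- If `H` is obtained from `K` by adding at most the edge `pq`, then every vertex reachable from
`p` in `H` is reachable from `p` or from `q` in `K`. -/
lemma Reachable.of_add_edge {H K : SimpleGraph V} {p q w : V}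
    (hHK : ∀ a b, H.Adj a b → K.Adj a b ∨ s(a, b) = s(p, q)) (h : H.Reachable p w) :
    K.Reachable p w ∨ K.Reachable q w := by
  refine h.induct (P := fun w => K.Reachable p w ∨ K.Reachable q w) (Or.inl .rfl) ?_
  intro x y hx hxy
  rcases hHK x y hxy with hK | he
  · exact hx.imp (·.trans hK.reachable) (·.trans hK.reachable)
  · rcases Sym2.eq_iff.1 he with ⟨-, rfl⟩ | ⟨-, rfl⟩
    · exact Or.inr .rfl
    · exact Or.inl .rfl

/-- The edges of `G` with exactly one end in `A`. -/
def cut (G : SimpleGraph V) (A : Set V) : Set (Sym2 V) :=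
  {e ∈ G.edgeSet | ∃ u ∈ A, ∃ v ∉ A, e = s(u, v)}

lemma mk_mem_cut {G : SimpleGraph V} {A : Set V} {a b : V} :
    s(a, b) ∈ G.cut A ↔ G.Adj a b ∧ ¬ (a ∈ A ↔ b ∈ A) := by
  simp only [cut, Set.mem_ofPred_eq, mem_edgeSet, Sym2.eq_iff]
  refine and_congr_right fun _ => ⟨?_, fun h => ?_⟩
  · rintro ⟨u, hu, v, hv, ⟨rfl, rfl⟩ | ⟨rfl, rfl⟩⟩ <;> tauto
  · by_cases ha : a ∈ A
    · exact ⟨a, ha, b, by tauto, by tauto⟩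
    · exact ⟨b, by tauto, a, ha, by tauto⟩

lemma isEdgeCut_cut {G : SimpleGraph V} {A : Set V} {a b : V} (ha : a ∈ A) (hb : b ∉ A) :
    IsEdgeCut G (G.cut A) := by
  refine ⟨fun e he => he.1, fun h => hb ?_⟩
  refine (h.preconnected a b).induct (P := (· ∈ A)) ha fun x y hx hxy => ?_
  rw [deleteEdges_adj, mk_mem_cut] at hxy
  tauto

lemma isMinimalEdgeCut_cut {G : SimpleGraph V} {A : Set V} {a b : V} (ha : a ∈ A) (hb : b ∉ A)
    (hA : ∀ w ∈ A, (G.deleteEdges (G.cut A)).Reachable a w)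
    (hB : ∀ w ∉ A, (G.deleteEdges (G.cut A)).Reachable b w) :
    IsMinimalEdgeCut G (G.cut A) := by
  refine ⟨isEdgeCut_cut ha hb, fun D hD hDA e he => by_contra fun heD => hD.2 ?_⟩
  obtain ⟨heG, u, hu, v, hv, rfl⟩ := he
  have hle : G.deleteEdges (G.cut A) ≤ G.deleteEdges D := deleteEdges_anti hDA
  have huv : (G.deleteEdges D).Reachable u v := by
    refine Adj.reachable ?_
    rw [deleteEdges_adj]
    exact ⟨heG, heD⟩
  have key : ∀ w, (G.deleteEdges D).Reachable a w := by
    intro w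
    by_cases hw : w ∈ A
    · exact (hA w hw).mono hle
    · exact (((hA u hu).mono hle).trans huv).trans
        (((hB v hv).symm.trans (hB w hw)).mono hle)
  exact (connected_iff_exists_forall_reachable _).2 ⟨a, key⟩

/-- If the vertices of `K ≤ G` form three components, two of which are joined by an edge of `G`,
then the edges of `G` leaving the third one form a minimal edge cut. -/
lemma isMinimalEdgeCut_cut_of_three {G K : SimpleGraph V} (hK : K ≤ G) {p q b : V}
    (hpb : ¬ K.Reachable p b)
    (hall : ∀ w, K.Reachable p w ∨ K.Reachable q w ∨ K.Reachable b w)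
    (hpq : ¬ K.Reachable p q)
    (hadj : ∃ x y, K.Reachable q x ∧ K.Reachable b y ∧ G.Adj x y) :
    IsMinimalEdgeCut G (G.cut {w | K.Reachable p w}) := by
  have hle : K ≤ G.deleteEdges (G.cut {w | K.Reachable p w}) := by
    intro x y hxy
    rw [deleteEdges_adj, mk_mem_cut]
    refine ⟨hK hxy, fun h => h.2 ⟨fun hx => ?_, fun hy => ?_⟩⟩
    · exact Reachable.trans hx hxy.reachable
    · exact Reachable.trans hy hxy.symm.reachable
  obtain ⟨x, y, hx, hy, hxy⟩ := hadj
  have hqb : (G.deleteEdges (G.cut {w | K.Reachable p w})).Reachable b q := by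
    refine ((hy.mono hle).trans (Adj.reachable ?_)).trans (hx.symm.mono hle)
    rw [deleteEdges_adj, mk_mem_cut]
    refine ⟨hxy.symm, fun h => h.2 (iff_of_false (fun h1 => ?_) (fun h1 => ?_))⟩
    · exact hpb (Reachable.trans h1 hy.symm)
    · exact hpq (Reachable.trans h1 hx.symm)
  refine isMinimalEdgeCut_cut (a := p) (b := b) (Reachable.refl p) hpb
    (fun w hw => Reachable.mono hle hw) fun w hw => ?_
  rcases hall w with h | h | h
  · exact absurd h hw
  · exact hqb.trans (h.mono hle)
  · exact h.mono hle

end SimpleGraph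

open SimpleGraph

lemma IsMinimalEdgeCut.not_reachable {V : Type*} {G : SimpleGraph V} {C : Set (Sym2 V)}
    (hC : IsMinimalEdgeCut G C) {a b : V} (hab : s(a, b) ∈ C) :
    (¬ (G.deleteEdges C).Reachable a b) ∧
      ∀ w, (G.deleteEdges C).Reachable a w ∨ (G.deleteEdges C).Reachable b w := by
  have hconn : (G.deleteEdges (C \ {s(a, b)})).Connected := by
    by_contra h
    have h2 := hC.2 (y := C \ {s(a, b)}) ⟨fun e he => hC.1.1 he.1, h⟩ Set.sdiff_subset hab
    exact h2.2 rfl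
  have hall : ∀ w, (G.deleteEdges C).Reachable a w ∨ (G.deleteEdges C).Reachable b w := by
    refine fun w => (hconn.preconnected a w).of_add_edge fun x y hxy => ?_
    simp only [deleteEdges_adj, Set.mem_sdiff, Set.mem_singleton_iff] at hxy ⊢
    tauto
  refine ⟨fun h => hC.1.2 ?_, hall⟩
  exact (connected_iff_exists_forall_reachable _).2
    ⟨a, fun w => (hall w).elim id h.trans⟩

lemma IsMinimalEdgeCut.nonempty {V : Type*} {G : SimpleGraph V} (hG : G.Connected)
    {C : Set (Sym2 V)} (hC : IsMinimalEdgeCut G C) : C.Nonempty := by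
  rw [Set.nonempty_iff_ne_empty]
  rintro rfl
  exact hC.1.2 (by simpa using hG)

lemma AttainsMinTwice.of_elimination {α : Type*} {x : α → ℝ} {C C₁ C₂ : Set α} {f : α}
    (h₁ : AttainsMinTwice C₁ x) (h₂ : AttainsMinTwice C₂ x) (hf₁ : f ∈ C₁) (hf₂ : f ∈ C₂)
    (hinter : C₁ ∩ C₂ ⊆ {f}) (hC : C ⊆ C₁ ∪ C₂) (hC₁ : C₁ \ {f} ⊆ C) (hC₂ : C₂ \ {f} ⊆ C) :
    AttainsMinTwice C x := by
  wlog hle : ∃ i ∈ C₁, (∀ k ∈ C₁, x i ≤ x k) ∧ ∀ k ∈ C₂, x i ≤ x k generalizing C₁ C₂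
  · refine this h₂ h₁ hf₂ hf₁ (by rwa [Set.inter_comm]) (by rwa [Set.union_comm]) hC₂ hC₁ ?_
    obtain ⟨i, hi, -, -, -, -, hmin₁⟩ := h₁
    obtain ⟨j, hj, -, -, -, -, hmin₂⟩ := h₂
    push Not at hle
    obtain ⟨k, hk, hk'⟩ := hle i hi hmin₁
    exact ⟨j, hj, hmin₂, fun l hl => by linarith [hmin₁ l hl, hmin₂ k hk]⟩
  obtain ⟨i₀, hi₀, hm₁, hm₂⟩ := hle
  obtain ⟨i, hi, j, hj, hij, hxij, hmin₁⟩ := h₁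
  have hi0 : x i = x i₀ := le_antisymm (hmin₁ _ hi₀) (hm₁ _ hi)
  have hmin : ∀ k ∈ C, x i ≤ x k := fun k hk => hi0 ▸ (hC hk).elim (hm₁ k) (hm₂ k)
  by_cases hif : i ≠ f ∧ j ≠ f
  · exact ⟨i, hC₁ ⟨hi, hif.1⟩, j, hC₁ ⟨hj, hif.2⟩, hij, hxij, hmin⟩
  obtain ⟨i', hi', hif', hxi', hxf⟩ : ∃ i' ∈ C₁, i' ≠ f ∧ x i' = x i ∧ x f = x i := by
    by_cases h : i = f
    · exact ⟨j, hj, fun h' => hij (h.trans h'.symm), hxij.symm, h ▸ rfl⟩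
    · have : j = f := by tauto
      exact ⟨i, hi, h, rfl, this ▸ hxij.symm⟩
  obtain ⟨k, hk, l, hl, hkl, hxkl, hmin₂⟩ := h₂
  have hxk : x k = x i := le_antisymm (hxf ▸ hmin₂ f hf₂) (hi0 ▸ hm₂ k hk)
  obtain ⟨k', hk', hkf', hxk'⟩ : ∃ k' ∈ C₂, k' ≠ f ∧ x k' = x i := by
    by_cases h : k = f
    · exact ⟨l, hl, fun h' => hkl (h.trans h'.symm), hxkl ▸ hxk⟩
    · exact ⟨k, hk, h, hxk⟩
  refine ⟨i', hC₁ ⟨hi', hif'⟩, k', hC₂ ⟨hk', hkf'⟩, ?_, hxi'.trans hxk'.symm, hxi' ▸ hmin⟩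
  rintro rfl
  exact hif' (hinter ⟨hi', hk'⟩)

lemma ThreeEdgeConnected.three_le_ncard {V : Type*} {G : SimpleGraph V}
    (hG : ThreeEdgeConnected G) {D : Set (Sym2 V)} (hD : IsEdgeCut G D) : 3 ≤ D.ncard := by
  by_contra h
  exact hD.2 (hG.2 D (by omega))

/-- A bridge of a component of `H` disconnects its ends in `H`. -/
lemma SimpleGraph.ConnectedComponent.exists_of_not_twoEdgeConnected {V : Type*}
    {H : SimpleGraph V} (c : H.ConnectedComponent) (hc : ¬ TwoEdgeConnected (H.induce c.supp)) :
    ∃ p q, H.connectedComponentMk p = c ∧ H.Adj p q ∧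
      ¬ (H.deleteEdges {s(p, q)}).Reachable p q := by
  have hconn : (H.induce c.supp).Connected := c.connected_toSimpleGraph
  simp only [TwoEdgeConnected, not_and, not_forall, not_not] at hc
  obtain ⟨e, he⟩ := hc hconn
  induction e with | _ p q
  have hadj : (H.induce c.supp).Adj p q := he.reachable_iff_adj.1 (hconn.preconnected p q)
  refine ⟨p, q, p.2, hadj, fun h => isBridge_iff.1 he ?_⟩
  suffices ∃ hq : (q : V) ∈ c.supp,
      ((H.induce c.supp).deleteEdges {s(p, q)}).Reachable p ⟨q, hq⟩ from this.2
  refine h.induct (P := fun w => ∃ hw : w ∈ c.supp,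
    ((H.induce c.supp).deleteEdges {s(p, q)}).Reachable p ⟨w, hw⟩) ⟨p.2, .rfl⟩ ?_
  rintro x y ⟨hx, hpx⟩ hxy
  rw [deleteEdges_adj] at hxy
  have hy : y ∈ c.supp := c.mem_supp_of_adj_mem_supp hx hxy.1
  refine ⟨hy, hpx.trans (Adj.reachable ?_)⟩
  rw [deleteEdges_adj]
  refine ⟨hxy.1, fun h => hxy.2 ?_⟩
  have := congrArg (Sym2.map Subtype.val) (Set.mem_singleton_iff.1 h)
  simpa using this

/-- A minimal edge cut that is not good arises by eliminating a common edge from two smaller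
minimal edge cuts. -/
lemma IsMinimalEdgeCut.exists_elimination {V : Type*} {G : SimpleGraph V}
    (hG : ThreeEdgeConnected G) {C : Set (Sym2 V)} (hC : IsMinimalEdgeCut G C)
    (hgood : ¬ IsGoodCut G C) :
    ∃ f C₁ C₂, IsMinimalEdgeCut G C₁ ∧ IsMinimalEdgeCut G C₂ ∧ f ∈ C₁ ∧ f ∈ C₂ ∧
      C₁ ∩ C₂ ⊆ {f} ∧ C ⊆ C₁ ∪ C₂ ∧ C₁ \ {f} ⊆ C ∧ C₂ \ {f} ⊆ C := by
  obtain ⟨e, he⟩ := hC.nonempty hG.1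
  obtain ⟨p, q, b, hpqH, hK, hpbH, hallH⟩ : ∃ p q b, (G.deleteEdges C).Adj p q ∧
      ¬ ((G.deleteEdges C).deleteEdges {s(p, q)}).Reachable p q ∧
      (¬ (G.deleteEdges C).Reachable p b) ∧
      ∀ w, (G.deleteEdges C).Reachable p w ∨ (G.deleteEdges C).Reachable b w := by
    induction e with | _ u v
    obtain ⟨huv, hall⟩ := hC.not_reachable he
    have hor : ¬ TwoEdgeConnected ((G.deleteEdges C).induce
          ((G.deleteEdges C).connectedComponentMk u).supp) ∨
        ¬ TwoEdgeConnected ((G.deleteEdges C).induce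
          ((G.deleteEdges C).connectedComponentMk v).supp) := by
      by_contra! h
      refine hgood ⟨hC, _, _, fun h' => huv (ConnectedComponent.exact h'), ?_, h.1, h.2⟩
      refine ConnectedComponent.ind fun w => ?_
      exact (hall w).imp (fun h => ConnectedComponent.sound h.symm)
        (fun h => ConnectedComponent.sound h.symm)
    rcases hor with h | h
    · obtain ⟨p, q, hp, hpq, hn⟩ := ConnectedComponent.exists_of_not_twoEdgeConnected _ h
      have hp' := ConnectedComponent.exact hp
      exact ⟨p, q, v, hpq, hn, fun h => huv (hp'.symm.trans h),
        fun w => (hall w).imp_left hp'.trans⟩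
    · obtain ⟨p, q, hp, hpq, hn⟩ := ConnectedComponent.exists_of_not_twoEdgeConnected _ h
      have hp' := ConnectedComponent.exact hp
      exact ⟨p, q, u, hpq, hn, fun h => huv (hp'.symm.trans h).symm,
        fun w => (hall w).symm.imp_left hp'.trans⟩
  set H := G.deleteEdges C with hH
  set K := H.deleteEdges {s(p, q)} with hKdef
  have hKH : K ≤ H := deleteEdges_le _
  have hKG : K ≤ G := hKH.trans (deleteEdges_le _)
  have hpb : ¬ K.Reachable p b := fun h => hpbH (h.mono hKH)
  have hqb : ¬ K.Reachable q b := fun h => hpbH (hpqH.reachable.trans (h.mono hKH))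
  have hKb : ∀ w, H.Reachable b w → K.Reachable b w := by
    intro w hw
    refine hw.induct (P := fun w => K.Reachable b w) .rfl fun x y hx hxy => ?_
    by_cases hxy' : s(x, y) = s(p, q)
    · rcases Sym2.eq_iff.1 hxy' with ⟨rfl, rfl⟩ | ⟨rfl, rfl⟩
      · exact absurd hx.symm hpb
      · exact absurd hx.symm hqb
    · refine hx.trans (Adj.reachable ?_)
      rw [hKdef, deleteEdges_adj]
      exact ⟨hxy, hxy'⟩
  have hall : ∀ w, K.Reachable p w ∨ K.Reachable q w ∨ K.Reachable b w := by
    intro w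
    rcases hallH w with h | h
    · rcases h.of_add_edge (K := K) (fun x y hxy => by
        rw [hKdef, deleteEdges_adj, Set.mem_singleton_iff]; tauto) with h | h
      · exact Or.inl h
      · exact Or.inr (Or.inl h)
    · exact Or.inr (Or.inr (hKb w h))
  have hCb : ∀ x y, s(x, y) ∈ C → ¬ (K.Reachable b x ↔ K.Reachable b y) := by
    intro x y hxy hiff
    have hn := (hC.not_reachable hxy).1
    by_cases hx : K.Reachable b x
    · exact hn ((hx.symm.trans (hiff.1 hx)).mono hKH)
    · have hx' := (hallH x).resolve_right fun h => hx (hKb x h)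
      have hy' := (hallH y).resolve_right fun h => hx (hiff.2 (hKb y h))
      exact hn (hx'.symm.trans hy')
  have hGe : ∀ x y, G.Adj x y → K.Adj x y ∨ s(x, y) = s(p, q) ∨ s(x, y) ∈ C := by
    intro x y hxy
    rw [hKdef, deleteEdges_adj, hH, deleteEdges_adj, Set.mem_singleton_iff]
    tauto
  have hdisj : ∀ a b w, ¬ K.Reachable a b → K.Reachable a w → ¬ K.Reachable b w :=
    fun a b w h h1 h2 => h (h1.trans h2.symm)
  have hcut : ∀ a, G.cut {w | K.Reachable a w} \ {s(p, q)} ⊆ C := by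
    rintro a e ⟨he, hf⟩
    induction e with | _ x y
    rw [mk_mem_cut] at he
    rcases hGe x y he.1 with h | h | h
    · exact absurd ⟨fun hx => hx.trans h.reachable, fun hy => hy.trans h.symm.reachable⟩ he.2
    · exact absurd h hf
    · exact h
  have hadj : ∀ a, ¬ K.Reachable a b →
      ∃ x y, K.Reachable a x ∧ K.Reachable b y ∧ G.Adj x y := by
    intro a hab
    have h3 := hG.three_le_ncard (isEdgeCut_cut (G := G) (A := {w | K.Reachable a w})
      (Reachable.refl a) hab)
    obtain ⟨e, he, hne⟩ : ∃ e ∈ G.cut {w | K.Reachable a w}, e ≠ s(p, q) := by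
      by_contra! h
      have := Set.ncard_le_ncard (t := {s(p, q)}) h
      rw [Set.ncard_singleton] at this
      omega
    have heC := hcut a ⟨he, hne⟩
    obtain ⟨heG, x, hx, y, hy, rfl⟩ := he
    have := hCb x y heC
    have := hdisj a b x hab hx
    exact ⟨x, y, hx, by tauto, heG⟩
  have hpG : G.Adj p q := deleteEdges_le _ hpqH
  refine ⟨s(p, q), G.cut {w | K.Reachable p w}, G.cut {w | K.Reachable q w},
    isMinimalEdgeCut_cut_of_three hKG hpb hall hK (hadj q hqb),
    isMinimalEdgeCut_cut_of_three hKG hqb (fun w => by have := hall w; tauto)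
      (fun h => hK h.symm) (hadj p hpb), ?_, ?_, ?_, ?_, hcut p, hcut q⟩
  · rw [mk_mem_cut]
    exact ⟨hpG, fun h => hK (h.1 (Reachable.refl p))⟩
  · rw [mk_mem_cut]
    exact ⟨hpG, fun h => hK (Reachable.symm (h.2 (Reachable.refl q)))⟩
  · rintro e ⟨h₁, h₂⟩
    by_contra hf
    have heC := hcut p ⟨h₁, hf⟩
    induction e with | _ x y
    rw [mk_mem_cut, Set.mem_ofPred_eq, Set.mem_ofPred_eq] at h₁ h₂
    have := hCb x y heC
    have := hdisj p b x hpb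
    have := hdisj p b y hpb
    have := hdisj q b x hqb
    have := hdisj q b y hqb
    tauto
  · intro e he
    induction e with | _ x y
    have hxy : G.Adj x y := hC.1.1 he
    simp only [Set.mem_union, mk_mem_cut, Set.mem_ofPred_eq]
    have := hCb x y he
    have := hdisj p b x hpb
    have := hdisj p b y hpb
    have := hdisj q b x hqb
    have := hdisj q b y hqb
    have := hall x
    have := hall y
    tauto

lemma attainsMinTwice_of_forall_isGoodCut {V : Type*} [Finite V] {G : SimpleGraph V}
    (hG : ThreeEdgeConnected G) {x : Sym2 V → ℝ} (hx : ∀ C, IsGoodCut G C → AttainsMinTwice C x)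
    (C : Set (Sym2 V)) (hC : IsMinimalEdgeCut G C) : AttainsMinTwice C x := by
  induction hn : C.ncard using Nat.strong_induction_on generalizing C with
  | _ n ih
  subst hn
  by_cases hgood : IsGoodCut G C
  · exact hx C hgood
  obtain ⟨f, C₁, C₂, h₁, h₂, hf₁, hf₂, hi, hu, hd₁, hd₂⟩ := hC.exists_elimination hG hgood
  have hn₁ := hG.three_le_ncard h₁.1
  have hn₂ := hG.three_le_ncard h₂.1
  have hdisj : Disjoint (C₁ \ {f}) (C₂ \ {f}) :=
    Set.disjoint_left.2 fun e he he' => he.2 (hi ⟨he.1, he'.1⟩)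
  have hcard := Set.ncard_le_ncard (Set.union_subset hd₁ hd₂)
  rw [Set.ncard_union_eq hdisj, Set.ncard_sdiff_singleton_of_mem hf₁,
    Set.ncard_sdiff_singleton_of_mem hf₂] at hcard
  exact (ih _ (by omega) C₁ h₁ rfl).of_elimination (ih _ (by omega) C₂ h₂ rfl)
    hf₁ hf₂ hi hu hd₁ hd₂

/-- A minimal edge cut different from a good cut `C` contains two edges outside `C`. -/
lemma IsGoodCut.exists_ne_of_ne {V : Type*} {G : SimpleGraph V} {C D : Set (Sym2 V)}
    (hC : IsGoodCut G C) (hD : IsMinimalEdgeCut G D) (hne : D ≠ C) :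
    ∃ e ∈ D \ C, ∃ f ∈ D \ C, e ≠ f := by
  obtain ⟨hCmin, c₁, c₂, -, hc, h₁, h₂⟩ := hC
  have hnot : ¬ D ⊆ C := fun h => hne (h.antisymm (hCmin.2 hD.1 h))
  obtain ⟨e, heD, heC⟩ := Set.not_subset.1 hnot
  refine ⟨e, ⟨heD, heC⟩, ?_⟩
  by_contra! h
  induction e with | _ u v
  have huv : (G.deleteEdges C).Adj u v := by
    rw [deleteEdges_adj]
    exact ⟨hD.1.1 heD, heC⟩
  obtain ⟨c, huc, hc2⟩ : ∃ c : (G.deleteEdges C).ConnectedComponent, u ∈ c.supp ∧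
      TwoEdgeConnected ((G.deleteEdges C).induce c.supp) := by
    rcases hc ((G.deleteEdges C).connectedComponentMk u) with h | h
    · exact ⟨c₁, h, h₁⟩
    · exact ⟨c₂, h, h₂⟩
  have hvc : v ∈ c.supp := c.mem_supp_of_adj_mem_supp huc huv
  have hb := hc2.2 s(⟨u, huc⟩, ⟨v, hvc⟩)
  rw [isBridge_iff, not_not] at hb
  refine (hD.not_reachable heD).1 ?_
  refine hb.induct (P := fun w => (G.deleteEdges D).Reachable u w.1) .rfl ?_
  intro x y hx hxy
  rw [deleteEdges_adj] at hxy
  have hxy1 : (G.deleteEdges C).Adj x y := hxy.1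
  rw [deleteEdges_adj] at hxy1
  refine hx.trans (Adj.reachable ?_)
  rw [deleteEdges_adj]
  refine ⟨hxy1.1, fun hmem => hxy.2 ?_⟩
  have := h _ ⟨hmem, hxy1.2⟩
  simpa [Sym2.eq_iff, Subtype.ext_iff, eq_comm, and_comm] using this

/-- A good cut `C` is separated from all other minimal edge cuts by some vector. -/
lemma IsGoodCut.exists_attainsMinTwice {V : Type*} {G : SimpleGraph V} (hG : G.Connected)
    {C : Set (Sym2 V)} (hC : IsGoodCut G C) :
    ∃ x : Sym2 V → ℝ, ¬ AttainsMinTwice C x ∧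
      ∀ D, IsMinimalEdgeCut G D → D ≠ C → AttainsMinTwice D x := by
  classical
  obtain ⟨e₀, he₀⟩ := hC.1.nonempty hG
  refine ⟨fun e => if e ∈ C ∧ e ≠ e₀ then 1 else 0, ?_, fun D hD hne => ?_⟩
  · rintro ⟨i, hi, j, hj, hij, hxij, hmin⟩
    have h0 := hmin e₀ he₀
    by_cases hi0 : i = e₀ <;> by_cases hj0 : j = e₀ <;> simp_all
    linarith
  · obtain ⟨e, he, f, hf, hef⟩ := hC.exists_ne_of_ne hD hne
    refine ⟨e, he.1, f, hf.1, hef, by simp [he.2, hf.2], fun k _ => ?_⟩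
    simp only [he.2, false_and, if_false]
    split_ifs <;> norm_num

/-- for the cographic matroid of a finite connected 3-edge-connected
simple graph `G`, whose circuits `𝒞` are the minimal edge cuts, a subfamily `ℬ ⊆ 𝒞`
satisfies `T(ℬ) = T(𝒞)` iff `ℬ` contains every minimal edge cut that splits `G` into
two 2-edge-connected components; these cuts form the unique minimal tropical basis. -/
theorem stmt10 {V : Type*} [Fintype V] (G : SimpleGraph V) (hG : ThreeEdgeConnected G)
    (𝒞 : Set (Set (Sym2 V))) (h𝒞 : 𝒞 = {C | IsMinimalEdgeCut G C})
    (𝒮 : Set (Set (Sym2 V))) (h𝒮 : 𝒮 = {C | IsGoodCut G C})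
    (ℬ : Set (Set (Sym2 V))) (hℬ : ℬ ⊆ 𝒞) :
    tropT ℬ = tropT 𝒞 ↔ 𝒮 ⊆ ℬ := by
  subst h𝒞 h𝒮
  constructor
  · intro h C hC
    by_contra hCB
    obtain ⟨x, hx, hxD⟩ := IsGoodCut.exists_attainsMinTwice hG.1 hC
    have hxB : x ∈ tropT ℬ := fun D hD => hxD D (hℬ hD) (ne_of_mem_of_not_mem hD hCB)
    rw [h] at hxB
    exact hx (hxB C hC.1)
  · intro h
    refine Set.Subset.antisymm (fun x hx C hC => ?_) fun x hx C hC => hx C (hℬ hC)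
    exact attainsMinTwice_of_forall_isGoodCut hG (fun D hD => hx D (h hD)) C hC
end

section
/- Let G be a finite connected 3-edge-connected simple graph and let C be a minimal edge cut of G such that deleting C leaves exactly two connected components, each 2-edge-connected. Then there exists an edge-weight vector x : E(G) → ℝ whose minimum over C is attained by exactly one edge of C, while for every minimal edge cut C' ≠ C of G the minimum of x over C' is attained by at least two distinct edges. Consequently, every tropical basis of the cographic matroid of G must contain C. -/
theorem IsMinimalEdgeCut.not_reachable_s11 {V : Type*} {G : SimpleGraph V} {D : Set (Sym2 V)}
    (hD : IsMinimalEdgeCut G D) {u v : V} (h : s(u, v) ∈ D) :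
    ¬ (G.deleteEdges D).Reachable u v := by
  intro hr
  have hcut : IsEdgeCut G (D \ {s(u, v)}) := by
    refine ⟨Set.sdiff_subset.trans hD.prop.1, fun hconn => hD.prop.2 ?_⟩
    have := hconn.nonempty
    refine ⟨fun a b => ?_⟩
    obtain ⟨p⟩ := hconn.preconnected a b
    induction p with
    | nil => exact .refl _
    | @cons a c b hadj p ih =>
      refine SimpleGraph.Reachable.trans ?_ ih
      rw [SimpleGraph.deleteEdges_adj] at hadj
      by_cases hac : s(a, c) = s(u, v)
      · rcases Sym2.eq_iff.1 hac with ⟨rfl, rfl⟩ | ⟨rfl, rfl⟩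
        · exact hr
        · exact hr.symm
      · exact (SimpleGraph.deleteEdges_adj.2
          ⟨hadj.1, fun hm => hadj.2 ⟨hm, hac⟩⟩ : (G.deleteEdges D).Adj a c).reachable
  exact (hD.le_of_le hcut Set.sdiff_subset h).2 rfl

/-- A minimal edge cut using an edge inside a bridgeless induced piece of `G.deleteEdges C`
uses a second edge outside `C`. -/
theorem IsMinimalEdgeCut.exists_ne_of_twoEdgeConnected {V : Type*} {G : SimpleGraph V}
    {C D : Set (Sym2 V)} (hD : IsMinimalEdgeCut G D) {S : Set V}
    (hS : TwoEdgeConnected ((G.deleteEdges C).induce S)) {u v : V} (hu : u ∈ S) (hv : v ∈ S)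
    (huv : s(u, v) ∈ D) : ∃ f ∈ D, f ∉ C ∧ f ≠ s(u, v) := by
  by_contra! hcon
  have hb := hS.2 s(⟨u, hu⟩, ⟨v, hv⟩)
  rw [SimpleGraph.isBridge_iff] at hb
  rw [not_not] at hb
  refine hD.not_reachable_s11 huv (hb.map (G' := G.deleteEdges D) ⟨Subtype.val, ?_⟩)
  intro a b hab
  rw [SimpleGraph.deleteEdges_adj] at hab
  obtain ⟨habG, habC⟩ := SimpleGraph.deleteEdges_adj.1 (SimpleGraph.comap_adj.1 hab.1)
  refine SimpleGraph.deleteEdges_adj.2 ⟨habG, fun habD => hab.2 ?_⟩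
  have h := hcon _ habD habC
  exact Sym2.map.injective Subtype.val_injective h

/-- for a finite connected 3-edge-connected simple graph `G` and a
minimal edge cut `C` splitting `G` into two 2-edge-connected components, there is an
edge-weight vector whose minimum over `C` is attained exactly once while its minimum
over every other minimal edge cut is attained at least twice; consequently every
tropical basis of the cographic matroid of `G` contains `C`. -/
theorem stmt11 {V : Type*} [Fintype V] (G : SimpleGraph V) (hG : ThreeEdgeConnected G)
    (C : Set (Sym2 V)) (hC : IsGoodCut G C) :
    (∃ x : Sym2 V → ℝ, AttainsMinUniquely C x ∧
      ∀ C' : Set (Sym2 V), IsMinimalEdgeCut G C' → C' ≠ C → AttainsMinTwice C' x) ∧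
    ∀ ℬ : Set (Set (Sym2 V)), ℬ ⊆ {D | IsMinimalEdgeCut G D} →
      tropT ℬ = tropT {D | IsMinimalEdgeCut G D} → C ∈ ℬ := by
  have key : ∃ x : Sym2 V → ℝ, AttainsMinUniquely C x ∧
      ∀ C' : Set (Sym2 V), IsMinimalEdgeCut G C' → C' ≠ C → AttainsMinTwice C' x := by
    obtain ⟨hmin, c₁, c₂, -, hall, h₁, h₂⟩ := hC
    obtain ⟨e₀, he₀⟩ : C.Nonempty := by
      rw [Set.nonempty_iff_ne_empty]
      rintro rfl
      exact hmin.prop.2 (by simpa using hG.1)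
    classical
    refine ⟨fun f => if f ∈ C ∧ f ≠ e₀ then 1 else 0, ⟨e₀, he₀, ?_, ?_⟩, ?_⟩
    · intro f _
      dsimp only
      split_ifs <;> simp_all
    · intro f hf h
      by_contra hne
      simp [hf, hne] at h
    · intro D hD hne
      obtain ⟨e, heD, heC⟩ : ∃ e ∈ D, e ∉ C := by
        by_contra! hsub
        exact hne (Set.Subset.antisymm hsub (hmin.le_of_le hD.prop hsub))
      obtain ⟨f, hfD, hfC, hfe⟩ : ∃ f ∈ D, f ∉ C ∧ f ≠ e := by
        induction e with
        | h u v =>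
          have hadj : (G.deleteEdges C).Adj u v :=
            SimpleGraph.deleteEdges_adj.2 ⟨hD.prop.1 heD, heC⟩
          have huv := SimpleGraph.ConnectedComponent.sound hadj.reachable
          rcases hall ((G.deleteEdges C).connectedComponentMk u) with h | h
          · exact hD.exists_ne_of_twoEdgeConnected h₁ h (huv.symm.trans h) heD
          · exact hD.exists_ne_of_twoEdgeConnected h₂ h (huv.symm.trans h) heD
      refine ⟨e, heD, f, hfD, hfe.symm, by simp [heC, hfC], fun k _ => ?_⟩
      simp only [heC, false_and, if_false]
      split_ifs <;> simp
  refine ⟨key, fun ℬ hℬ hT => ?_⟩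
  obtain ⟨x, ⟨e, he, hle, huniq⟩, hx⟩ := key
  by_contra hCℬ
  have hmem : x ∈ tropT ℬ := fun D hDℬ => hx D (hℬ hDℬ) fun h => hCℬ (h ▸ hDℬ)
  rw [hT] at hmem
  obtain ⟨i, hi, j, hj, hij, hxij, hmin⟩ := hmem C hC.1
  have := hle i hi
  have := hmin e he
  exact hij ((huniq i hi (by linarith)).trans (huniq j hj (by linarith)).symm)
end

section
/- Let E be the edge set of the complete graph K₅ on vertex set {1, …, 5} (the 2-element subsets of {1, …, 5}), and let 𝒞 consist of the fifteen edge sets of 4-cycles of K₅ together with the fifteen complements in E of these 4-cycles; 𝒞 is the circuit family of the matroid R₁₀. Then a subset ℬ ⊆ 𝒞 satisfies T(ℬ) = T(𝒞) if and only if ℬ contains all fifteen 4-cycles; in particular the fifteen 4-cycles form the unique minimal tropical basis of R₁₀. -/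
/-- The complete graph `K₅` on five vertices. -/
def K5 : SimpleGraph (Fin 5) := ⊤

/-- `C` is the edge set of a 4-cycle of `K₅`. -/
def IsFourCycle (C : Set (Sym2 (Fin 5))) : Prop :=
  IsCycleEdgeSet K5 C ∧ C.ncard = 4

/-- The circuits of the matroid `R₁₀`: the fifteen 4-cycles of `K₅` together with
their fifteen complements in the edge set of `K₅`. -/
def R10Circuits : Set (Set (Sym2 (Fin 5))) :=
  {C | IsFourCycle C} ∪ {D | ∃ C : Set (Sym2 (Fin 5)), IsFourCycle C ∧ D = K5.edgeSet \ C}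

/-- The edges of the closed walk `p q r s p`. -/
def quadEdges {V : Type*} [DecidableEq V] (p q r s : V) : Finset (Sym2 V) :=
  {s(p, q), s(q, r), s(r, s), s(s, p)}

/-- The edge set of the 4-cycle `0 1 2 3` of `K₅`. -/
def stdQuad : Finset (Sym2 (Fin 5)) := quadEdges 0 1 2 3

theorem attainsMinTwice_image_iff {α β : Type*} {f : α → β} (hf : f.Injective) (C : Set α)
    (x : β → ℝ) : AttainsMinTwice (f '' C) x ↔ AttainsMinTwice C (x ∘ f) := by
  simp [AttainsMinTwice, hf.eq_iff]

theorem AttainsMinTwice.exists_le {α : Type*} {C : Set α} {x : α → ℝ} (h : AttainsMinTwice C x)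
    {i : α} (hi : i ∈ C) : ∃ j ∈ C, j ≠ i ∧ x j ≤ x i := by
  obtain ⟨a, ha, b, hb, hab, hxab, hmin⟩ := h
  by_cases hai : a = i
  · exact ⟨b, hb, fun hbi => hab (hai.trans hbi.symm), hxab ▸ hmin i hi⟩
  · exact ⟨a, ha, hai, hmin i hi⟩

theorem attainsMinTwice_of_exists_le {α : Type*} {C : Set α} {x : α → ℝ} (hC : C.Finite)
    (hne : C.Nonempty) (h : ∀ i ∈ C, ∃ j ∈ C, j ≠ i ∧ x j ≤ x i) : AttainsMinTwice C x := by
  obtain ⟨i, hi, hmin⟩ := Set.exists_min_image C x hC hne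
  obtain ⟨j, hj, hji, hle⟩ := h i hi
  exact ⟨i, hi, j, hj, hji.symm, le_antisymm (hmin j hj) hle, hmin⟩

theorem isFourCycle_iff {C : Set (Sym2 (Fin 5))} :
    IsFourCycle C ↔ ∃ p q r s : Fin 5, [p, q, r, s].Nodup ∧ C = quadEdges p q r s := by
  constructor
  · rintro ⟨⟨u, w, hw, rfl⟩, hcard⟩
    have hlen : w.length = 4 := by
      rw [← hcard, ← w.length_edges, ← List.toFinset_card_of_nodup hw.edges_nodup,
        ← Set.ncard_coe_finset]
      congr 1
      ext
      simp
    match w, hlen, hw with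
    | .cons (v := b) _ (.cons (v := c) _ (.cons (v := d) _ (.cons _ .nil))), _, hw =>
      refine ⟨u, b, c, d, ?_, ?_⟩
      · have := hw.support_nodup
        simp at this ⊢
        grind
      · ext
        simp [quadEdges]
  · rintro ⟨p, q, r, s, hnd, rfl⟩
    simp only [List.nodup_cons, List.mem_cons, List.not_mem_nil, or_false, not_or, not_false_eq_true,
      List.nodup_nil, and_true] at hnd
    obtain ⟨⟨hpq, hpr, hps⟩, ⟨hqr, hqs⟩, hrs⟩ := hnd
    refine ⟨⟨p, .cons (v := q) (by simpa [K5] using hpq) (.cons (v := r) (by simpa [K5] using hqr)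
      (.cons (v := s) (by simpa [K5] using hrs)
        (.cons (by simpa [K5] using Ne.symm hps) .nil))), ?_, ?_⟩, ?_⟩
    · simp [SimpleGraph.Walk.cons_isCycle_iff, SimpleGraph.Walk.isPath_def]
      grind
    · ext
      simp [quadEdges]
    · rw [Set.ncard_coe_finset, quadEdges]
      repeat rw [Finset.card_insert_of_notMem (by simp; grind)]
      simp

theorem IsFourCycle.image {C : Set (Sym2 (Fin 5))} (hC : IsFourCycle C)
    (σ : Equiv.Perm (Fin 5)) : IsFourCycle (Sym2.map σ '' C) := by
  obtain ⟨p, q, r, s, hnd, rfl⟩ := isFourCycle_iff.1 hC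
  refine isFourCycle_iff.2 ⟨σ p, σ q, σ r, σ s, hnd.map σ.injective, ?_⟩
  simp [quadEdges, Set.image_insert_eq]

theorem image_image_perm_symm (σ : Equiv.Perm (Fin 5)) (C : Set (Sym2 (Fin 5))) :
    Sym2.map σ '' (Sym2.map σ.symm '' C) = C := by
  simp [Set.image_image, Sym2.map_map]

theorem IsFourCycle.exists_perm {C : Set (Sym2 (Fin 5))} (hC : IsFourCycle C) :
    ∃ σ : Equiv.Perm (Fin 5), C = Sym2.map σ '' stdQuad := by
  obtain ⟨p, q, r, s, hnd, rfl⟩ := isFourCycle_iff.1 hC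
  obtain ⟨t, ht⟩ : ∃ t, t ∉ [p, q, r, s].toFinset := by
    by_contra! h
    have := Finset.card_le_card (fun a _ => h a : (Finset.univ : Finset (Fin 5)) ⊆ _)
    have := List.toFinset_card_le [p, q, r, s]
    simp at *
    omega
  have hinj : Function.Injective ![p, q, r, s, t] := by
    intro i j hij
    simp at hnd ht
    fin_cases i <;> fin_cases j <;> simp at hij ⊢ <;> grind
  refine ⟨Equiv.ofBijective _ (Finite.injective_iff_bijective.1 hinj), ?_⟩
  simp [stdQuad, quadEdges, Set.image_insert_eq]

theorem image_K5_edgeSet (σ : Equiv.Perm (Fin 5)) : Sym2.map σ '' K5.edgeSet = K5.edgeSet := by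
  ext e
  constructor
  · rintro ⟨f, hf, rfl⟩
    induction f with | _ a b => simpa [K5] using hf
  · intro he
    refine ⟨Sym2.map σ.symm e, ?_, by simp [Sym2.map_map]⟩
    induction e with | _ a b => simpa [K5] using he

theorem K5_edgeSet_diff_image (σ : Equiv.Perm (Fin 5)) (C : Set (Sym2 (Fin 5))) :
    K5.edgeSet \ Sym2.map σ '' C = Sym2.map σ '' (K5.edgeSet \ C) := by
  rw [Set.image_sdiff (Sym2.map.injective σ.injective), image_K5_edgeSet]

theorem image_mem_R10Circuits {C : Set (Sym2 (Fin 5))} (hC : C ∈ R10Circuits)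
    (σ : Equiv.Perm (Fin 5)) : Sym2.map σ '' C ∈ R10Circuits := by
  obtain hC | ⟨D, hD, rfl⟩ := hC
  · exact .inl (hC.image σ)
  · exact .inr ⟨_, hD.image σ, (K5_edgeSet_diff_image σ D).symm⟩

/-- The six edges of `K₅` outside the 4-cycle `0 1 2 3`. -/
theorem K5_edgeSet_diff_stdQuad : K5.edgeSet \ stdQuad =
    (({s(0, 2), s(1, 3), s(4, 0), s(4, 1), s(4, 2), s(4, 3)} : Finset (Sym2 (Fin 5))) :
      Set (Sym2 (Fin 5))) := by
  ext e
  induction e with | _ a b =>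
  simp only [K5, Set.mem_sdiff, SimpleGraph.mem_edgeSet, SimpleGraph.top_adj, Finset.mem_coe]
  revert a b
  decide

/-- A property of edges that no 4-cycle satisfies exactly once cannot hold for exactly one edge of
the complement of a 4-cycle: the case of a diagonal. -/
theorem exists_of_diagonal {V : Type*} {P : Sym2 V → Prop}
    (hP : ∀ p q r s : V, [p, q, r, s].Nodup →
      P s(p, q) → P s(q, r) ∨ P s(r, s) ∨ P s(s, p))
    (a b c d e : V) (h : [a, b, c, d, e].Nodup) (hac : P s(a, c)) :
    P s(b, d) ∨ P s(e, a) ∨ P s(e, b) ∨ P s(e, c) ∨ P s(e, d) := by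
  have h₁ := hP a c e b (by clear hP; simp at h ⊢; grind) hac
  have h₂ := hP b a e d (by clear hP; simp at h ⊢; grind)
  rw [Sym2.eq_swap (a := c) (b := e)] at h₁
  rw [Sym2.eq_swap (a := a) (b := e), Sym2.eq_swap (a := d) (b := b)] at h₂
  tauto

/-- The analogue of `exists_of_diagonal` for an edge at the vertex `e` off the 4-cycle `a b c d`. -/
theorem exists_of_spoke {V : Type*} {P : Sym2 V → Prop}
    (hP : ∀ p q r s : V, [p, q, r, s].Nodup →
      P s(p, q) → P s(q, r) ∨ P s(r, s) ∨ P s(s, p))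
    (a b c d e : V) (h : [a, b, c, d, e].Nodup) (hea : P s(e, a)) :
    P s(a, c) ∨ P s(b, d) ∨ P s(e, b) ∨ P s(e, c) ∨ P s(e, d) := by
  have h₁ := hP e a c b (by clear hP; simp at h ⊢; grind) hea
  have h₂ := hP c b d e (by clear hP; simp at h ⊢; grind)
  rw [Sym2.eq_swap (a := b) (b := e)] at h₁
  rw [Sym2.eq_swap (a := d) (b := e)] at h₂
  tauto

theorem attainsMinTwice_diff_stdQuad {x : Sym2 (Fin 5) → ℝ}
    (hx : ∀ C, IsFourCycle C → AttainsMinTwice C x) :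
    AttainsMinTwice (K5.edgeSet \ stdQuad) x := by
  have hP (t : ℝ) (p q r s : Fin 5) (hnd : [p, q, r, s].Nodup) (hpq : x s(p, q) ≤ t) :
      x s(q, r) ≤ t ∨ x s(r, s) ≤ t ∨ x s(s, p) ≤ t := by
    obtain ⟨j, hj, hne, hle⟩ := (hx _ (isFourCycle_iff.2 ⟨p, q, r, s, hnd, rfl⟩)).exists_le
      (i := s(p, q)) (by simp [quadEdges])
    simp only [quadEdges, Finset.mem_coe, Finset.mem_insert, Finset.mem_singleton] at hj
    have := hle.trans hpq
    rcases hj with rfl | rfl | rfl | rfl <;> tauto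
  rw [K5_edgeSet_diff_stdQuad]
  refine attainsMinTwice_of_exists_le (Finset.finite_toSet _) ⟨s(0, 2), by simp⟩ fun i hi => ?_
  have hD := exists_of_diagonal (P := fun f => x f ≤ x i) (hP _)
  have hS := exists_of_spoke (P := fun f => x f ≤ x i) (hP _)
  simp only [Finset.mem_coe, Finset.mem_insert, Finset.mem_singleton] at hi
  rcases hi with rfl | rfl | rfl | rfl | rfl | rfl
  · obtain h | h | h | h | h := hD 0 1 2 3 4 (by decide) le_rfl
    all_goals exact ⟨_, by decide, by decide, h⟩
  · obtain h | h | h | h | h := hD 1 2 3 0 4 (by decide) le_rfl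
    all_goals exact ⟨_, by decide, by decide, h⟩
  · obtain h | h | h | h | h := hS 0 1 2 3 4 (by decide) le_rfl
    all_goals exact ⟨_, by decide, by decide, h⟩
  · obtain h | h | h | h | h := hS 1 2 3 0 4 (by decide) le_rfl
    all_goals exact ⟨_, by decide, by decide, h⟩
  · obtain h | h | h | h | h := hS 2 3 0 1 4 (by decide) le_rfl
    all_goals exact ⟨_, by decide, by decide, h⟩
  · obtain h | h | h | h | h := hS 3 0 1 2 4 (by decide) le_rfl
    all_goals exact ⟨_, by decide, by decide, h⟩

theorem attainsMinTwice_of_forall_isFourCycle {x : Sym2 (Fin 5) → ℝ}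
    (hx : ∀ C, IsFourCycle C → AttainsMinTwice C x) {C : Set (Sym2 (Fin 5))}
    (hC : C ∈ R10Circuits) : AttainsMinTwice C x := by
  obtain hC | ⟨D, hD, rfl⟩ := hC
  · exact hx C hC
  · obtain ⟨σ, rfl⟩ := hD.exists_perm
    have hσ := Sym2.map.injective σ.injective
    rw [K5_edgeSet_diff_image, attainsMinTwice_image_iff hσ]
    exact attainsMinTwice_diff_stdQuad fun C hC =>
      (attainsMinTwice_image_iff hσ C x).1 (hx _ (hC.image σ))

/-- The path `1 2 3 0`, obtained from the 4-cycle `0 1 2 3` by removing an edge. -/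
def stdPath : Finset (Sym2 (Fin 5)) := {s(1, 2), s(2, 3), s(3, 0)}

/-- The indicator function of `stdPath`, a vector which lies in `T(C)` for every circuit `C`
of `R₁₀` other than the 4-cycle `0 1 2 3`. -/
def pathVector (e : Sym2 (Fin 5)) : ℝ := if e ∈ stdPath then 1 else 0

theorem not_attainsMinTwice_pathVector : ¬ AttainsMinTwice (stdQuad : Set _) pathVector := by
  intro h
  obtain ⟨j, hj, hne, hle⟩ := h.exists_le (i := s(0, 1)) (by decide)
  have hj' : ∀ j ∈ stdQuad, j ≠ s(0, 1) → j ∈ stdPath := by decide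
  have h01 : s(0, 1) ∉ stdPath := by decide
  simp only [pathVector, hj' j hj hne, h01, if_true, if_false] at hle
  linarith

theorem attainsMinTwice_pathVector_of_mem {C : Set (Sym2 (Fin 5))} {i j : Sym2 (Fin 5)}
    (hi : i ∈ C) (hj : j ∈ C) (hij : i ≠ j) (hi' : i ∉ stdPath) (hj' : j ∉ stdPath) :
    AttainsMinTwice C pathVector := by
  refine ⟨i, hi, j, hj, hij, by simp [pathVector, hi', hj'], fun k _ => ?_⟩
  simp only [pathVector, hi', if_false]
  split_ifs <;> norm_num

theorem exists_pair_mem_quadEdges_notMem_stdPath : ∀ p q r s : Fin 5, [p, q, r, s].Nodup →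
    quadEdges p q r s ≠ stdQuad →
    ∃ i ∈ quadEdges p q r s, ∃ j ∈ quadEdges p q r s, i ≠ j ∧ i ∉ stdPath ∧ j ∉ stdPath := by
  decide +kernel

theorem exists_pair_notMem_quadEdges_notMem_stdPath : ∀ p q r s : Fin 5, [p, q, r, s].Nodup →
    ∃ i ∉ quadEdges p q r s, ∃ j ∉ quadEdges p q r s,
      (¬ i.IsDiag ∧ ¬ j.IsDiag) ∧ i ≠ j ∧ i ∉ stdPath ∧ j ∉ stdPath := by
  decide +kernel

theorem attainsMinTwice_pathVector {C : Set (Sym2 (Fin 5))} (hC : C ∈ R10Circuits)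
    (hne : C ≠ stdQuad) : AttainsMinTwice C pathVector := by
  obtain hC | ⟨D, hD, rfl⟩ := hC
  · obtain ⟨p, q, r, s, hnd, rfl⟩ := isFourCycle_iff.1 hC
    obtain ⟨i, hi, j, hj, hij, hi', hj'⟩ :=
      exists_pair_mem_quadEdges_notMem_stdPath p q r s hnd (by simpa using hne)
    exact attainsMinTwice_pathVector_of_mem hi hj hij hi' hj'
  · obtain ⟨p, q, r, s, hnd, rfl⟩ := isFourCycle_iff.1 hD
    obtain ⟨i, hi, j, hj, hd, hij, hi', hj'⟩ :=
      exists_pair_notMem_quadEdges_notMem_stdPath p q r s hnd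
    refine attainsMinTwice_pathVector_of_mem (i := i) (j := j) ⟨?_, by simpa using hi⟩
      ⟨?_, by simpa using hj⟩ hij hi' hj'
    · simpa [K5] using hd.1
    · simpa [K5] using hd.2

/-- a subfamily `ℬ` of the circuits of `R₁₀` satisfies `T(ℬ) = T(𝒞)` iff
`ℬ` contains all fifteen 4-cycles; the 4-cycles form the unique minimal tropical basis
of `R₁₀`. -/
theorem stmt12 (ℬ : Set (Set (Sym2 (Fin 5)))) (hℬ : ℬ ⊆ R10Circuits) :
    tropT ℬ = tropT R10Circuits ↔ ∀ C : Set (Sym2 (Fin 5)), IsFourCycle C → C ∈ ℬ := by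
  constructor
  · intro h C₀ hC₀
    by_contra hmem
    obtain ⟨σ, rfl⟩ := hC₀.exists_perm
    have hσ := Sym2.map.injective σ.injective
    have hσ' := Sym2.map.injective σ.symm.injective
    have hx : pathVector ∘ Sym2.map σ.symm ∈ tropT ℬ := fun C hC => by
      rw [← attainsMinTwice_image_iff hσ']
      refine attainsMinTwice_pathVector (image_mem_R10Circuits (hℬ hC) σ.symm) fun heq => hmem ?_
      rwa [← heq, image_image_perm_symm]
    rw [h] at hx
    have := hx _ (.inl hC₀)
    rw [← attainsMinTwice_image_iff hσ'] at this
    have himg := image_image_perm_symm σ.symm (stdQuad : Set _)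
    rw [Equiv.symm_symm] at himg
    exact not_attainsMinTwice_pathVector (himg ▸ this)
  · intro h
    refine Set.Subset.antisymm (fun x hx C hC => ?_) fun x hx C hC => hx C (hℬ hC)
    exact attainsMinTwice_of_forall_isFourCycle (fun D hD => hx D (h D hD)) hC
end

section
/- Let E be the edge set of the complete graph K₅ on {1, …, 5}. If a 0/1-vector x : E → {0,1} attains its minimum uniquely on the complement of some 4-cycle of K₅ (i.e., exactly one edge of that 6-element complement has the minimum value of x over it), then x attains its minimum uniquely on the edge set of some 4-cycle of K₅. -/
theorem isFourCycle_of_pairwise_ne {a b c d : Fin 5} (hab : a ≠ b) (hac : a ≠ c) (had : a ≠ d)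
    (hbc : b ≠ c) (hbd : b ≠ d) (hcd : c ≠ d) :
    IsFourCycle {s(a, b), s(b, c), s(c, d), s(d, a)} := by
  refine ⟨⟨a, .cons (v := b) (by simpa [K5]) (.cons (v := c) (by simpa [K5])
    (.cons (v := d) (by simpa [K5]) (.cons (by simpa [K5] using had.symm) .nil))), ?_, ?_⟩, ?_⟩
  · simp [SimpleGraph.Walk.cons_isCycle_iff, SimpleGraph.Walk.cons_isPath_iff]
    grind
  · ext e
    simp
  · rw [Set.ncard_eq_toFinset_card']
    simp only [Set.toFinset_insert, Set.toFinset_singleton]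
    repeat rw [Finset.card_insert_of_notMem (by simp; grind)]
    simp

theorem IsFourCycle.exists_vertices {C : Set (Sym2 (Fin 5))} (hC : IsFourCycle C) :
    ∃ a b c d : Fin 5, a ≠ b ∧ a ≠ c ∧ a ≠ d ∧ b ≠ c ∧ b ≠ d ∧ c ≠ d ∧
      C = {s(a, b), s(b, c), s(c, d), s(d, a)} := by
  obtain ⟨⟨u, w, hw, rfl⟩, hcard⟩ := hC
  have hlen : w.length = 4 := by
    rw [← w.length_edges, ← List.toFinset_card_of_nodup hw.edges_nodup, ← hcard,
      ← Set.ncard_coe_finset]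
    simp
  match w, hw, hlen with
  | .cons (v := b) _ (.cons (v := c) _ (.cons (v := d) _ (.cons _ .nil))), hw, _ =>
    have hnd := hw.support_nodup
    simp at hnd
    refine ⟨u, b, c, d, ?_, ?_, ?_, ?_, ?_, ?_, ?_⟩
    iterate 6 grind
    ext e
    simp

/-- If `ab` is the only zero edge of the 4-cycle `abcd`, the minimum on it is unique. -/
theorem attainsMinUniquely_of_unique_zero {x : Sym2 (Fin 5) → ℝ} (h01 : ∀ e, x e = 0 ∨ x e = 1)
    {a b c d : Fin 5} (hab : x s(a, b) = 0) (hbc : x s(b, c) ≠ 0) (hcd : x s(c, d) ≠ 0)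
    (hda : x s(d, a) ≠ 0) :
    AttainsMinUniquely {s(a, b), s(b, c), s(c, d), s(d, a)} x := by
  refine ⟨s(a, b), by simp, fun f _ => ?_, fun f hf hfe => ?_⟩
  · rcases h01 f with h | h <;> rw [hab, h]
    norm_num
  · rw [hab] at hfe
    rcases hf with rfl | rfl | rfl | rfl <;> first | rfl | contradiction

/-- A graph `Z` in which no 4-cycle has exactly one edge cannot meet the complement of the 4-cycle
`abcd` in the single chord `ac`. -/
theorem not_chord_of_no_unique_edge {α : Type*} {Z : α → α → Prop} (hsymm : ∀ p q, Z p q → Z q p)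
    (hZ : ∀ p q r s, [p, q, r, s].Nodup → Z p q → ¬ Z q r → ¬ Z r s → Z s p)
    {a b c d v : α} (hnd : [a, b, c, d, v].Nodup) (hbd : ¬ Z b d)
    (hbv : ¬ Z b v) (hcv : ¬ Z c v) (hdv : ¬ Z d v) (hav : ¬ Z a v) : ¬ Z a c := by
  intro hac
  have hba := hZ a c v b
  have hda := hZ a c v d
  have habdv := hZ a b d v
  clear hZ
  grind

/-- A graph `Z` in which no 4-cycle has exactly one edge cannot meet the complement of the 4-cycle
`abcd` in the single spoke `av`. -/
theorem not_spoke_of_no_unique_edge {α : Type*} {Z : α → α → Prop} (hsymm : ∀ p q, Z p q → Z q p)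
    (hZ : ∀ p q r s, [p, q, r, s].Nodup → Z p q → ¬ Z q r → ¬ Z r s → Z s p)
    {a b c d v : α} (hnd : [a, b, c, d, v].Nodup) (hbd : ¬ Z b d)
    (hbv : ¬ Z b v) (hcv : ¬ Z c v) (hdv : ¬ Z d v) (hac : ¬ Z a c) : ¬ Z a v := by
  intro hav
  have hbc := hZ v a c b
  have hdc := hZ v a c d
  have hcbdv := hZ c b d v
  clear hZ
  grind

theorem nodup_rotate {α : Type*} {a b c d v : α} (hnd : [a, b, c, d, v].Nodup) :
    [b, c, d, a, v].Nodup := by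
  simp at hnd ⊢
  grind

/-- If `pq` is the only edge of `Z` in the complement of the 4-cycle `abcd`, then some 4-cycle has
exactly one edge in `Z`. -/
theorem false_of_unique_edge {α : Type*} {Z : α → α → Prop} (hsymm : ∀ p q, Z p q → Z q p)
    (hZ : ∀ p q r s, [p, q, r, s].Nodup → Z p q → ¬ Z q r → ¬ Z r s → Z s p)
    {a b c d v p q : α} (hnd : [a, b, c, d, v].Nodup)
    (hp : p = a ∨ p = b ∨ p = c ∨ p = d ∨ p = v) (hq : q = a ∨ q = b ∨ q = c ∨ q = d ∨ q = v)
    (hpq : ¬p = q ∧ ¬(p = a ∧ q = b ∨ p = b ∧ q = a) ∧ ¬(p = b ∧ q = c ∨ p = c ∧ q = b) ∧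
      ¬(p = c ∧ q = d ∨ p = d ∧ q = c) ∧ ¬(p = d ∧ q = a ∨ p = a ∧ q = d)) (hZpq : Z p q)
    (huniq : ∀ r s, (¬r = s ∧ ¬(r = a ∧ s = b ∨ r = b ∧ s = a) ∧
      ¬(r = b ∧ s = c ∨ r = c ∧ s = b) ∧ ¬(r = c ∧ s = d ∨ r = d ∧ s = c) ∧
      ¬(r = d ∧ s = a ∨ r = a ∧ s = d)) → Z r s → r = p ∧ s = q ∨ r = q ∧ s = p) : False := by
  have hnd₁ := nodup_rotate hnd
  have hnd₂ := nodup_rotate hnd₁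
  have hnd₃ := nodup_rotate hnd₂
  have hZac := not_chord_of_no_unique_edge hsymm hZ hnd
  have hZbd := not_chord_of_no_unique_edge hsymm hZ hnd₁
  have hZav := not_spoke_of_no_unique_edge hsymm hZ hnd
  have hZbv := not_spoke_of_no_unique_edge hsymm hZ hnd₁
  have hZcv := not_spoke_of_no_unique_edge hsymm hZ hnd₂
  have hZdv := not_spoke_of_no_unique_edge hsymm hZ hnd₃
  have hac := huniq a c
  have hbd := huniq b d
  have hav := huniq a v
  have hbv := huniq b v
  have hcv := huniq c v
  have hdv := huniq d v
  clear hZ huniq hnd₁ hnd₂ hnd₃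
  simp only [List.nodup_cons, List.mem_cons, List.not_mem_nil, or_false, not_or] at hnd
  rcases hp with rfl | rfl | rfl | rfl | rfl <;> rcases hq with rfl | rfl | rfl | rfl | rfl <;>
    grind

/-- if a 0/1 edge-weight vector on `K₅` attains its minimum uniquely on
the complement of some 4-cycle, then it attains its minimum uniquely on some 4-cycle. -/
theorem stmt13 (x : Sym2 (Fin 5) → ℝ) (h01 : ∀ e, x e = 0 ∨ x e = 1)
    (C : Set (Sym2 (Fin 5))) (hC : IsFourCycle C)
    (hmin : AttainsMinUniquely (K5.edgeSet \ C) x) :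
    ∃ C' : Set (Sym2 (Fin 5)), IsFourCycle C' ∧ AttainsMinUniquely C' x := by
  obtain ⟨a, b, c, d, hab, hac, had, hbc, hbd, hcd, rfl⟩ := hC.exists_vertices
  obtain ⟨v, hv⟩ : ∃ v, v ∉ ({a, b, c, d} : Finset (Fin 5)) := by
    by_contra! h
    have := Finset.card_le_card (fun v _ => h v : Finset.univ ⊆ {a, b, c, d})
    have := Finset.card_le_four (a := a) (b := b) (c := c) (d := d)
    simp at *
    omega
  by_contra! hno
  let Z (p q : Fin 5) : Prop := x s(p, q) = 0
  have hsymm : ∀ p q, Z p q → Z q p := fun p q h => by simpa [Z, Sym2.eq_swap] using h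
  have hZ : ∀ p q r s, [p, q, r, s].Nodup → Z p q → ¬ Z q r → ¬ Z r s → Z s p := by
    intro p q r s hnd hpq hqr hrs
    by_contra hsp
    simp at hnd
    exact hno _ (isFourCycle_of_pairwise_ne (by grind) (by grind) (by grind) (by grind) (by grind)
      (by grind)) (attainsMinUniquely_of_unique_zero h01 hpq hqr hrs hsp)
  have hmem : ∀ p q, s(p, q) ∈ K5.edgeSet \ {s(a, b), s(b, c), s(c, d), s(d, a)} ↔
      p ≠ q ∧ s(p, q) ≠ s(a, b) ∧ s(p, q) ≠ s(b, c) ∧ s(p, q) ≠ s(c, d) ∧ s(p, q) ≠ s(d, a) := by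
    simp [K5]
  simp only [ne_eq, Sym2.eq_iff] at hmem
  obtain ⟨e, he, hle, huniq⟩ := hmin
  have he0 : x e = 0 := by
    refine (h01 e).resolve_right fun h1 => ?_
    have key : ∀ f ∈ K5.edgeSet \ {s(a, b), s(b, c), s(c, d), s(d, a)}, f = e := fun f hf =>
      huniq f hf ((h01 f).elim (fun h => by linarith [hle f hf]) (fun h => h.trans h1.symm))
    have hchords : s(a, c) = s(b, d) :=
      (key _ ((hmem _ _).2 (by grind))).trans (key _ ((hmem _ _).2 (by grind))).symm
    rw [Sym2.eq_iff] at hchords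
    grind
  induction e with | _ p q
  have hother : ∀ r s, s(r, s) ∈ K5.edgeSet \ {s(a, b), s(b, c), s(c, d), s(d, a)} →
      Z r s → s(r, s) = s(p, q) := fun r s hrs h => huniq _ hrs (h.trans he0.symm)
  have hpq : Z p q := he0
  simp only [hmem, Sym2.eq_iff] at he hother
  clear_value Z
  simp only [Finset.mem_insert, Finset.mem_singleton, not_or] at hv
  have hcover : ∀ w, w = a ∨ w = b ∨ w = c ∨ w = d ∨ w = v := by
    clear * - hab hac had hbc hbd hcd hv
    omega
  have hnd : [a, b, c, d, v].Nodup := by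
    simp [hab, hac, had, hbc, hbd, hcd, Ne.symm hv.1, Ne.symm hv.2.1, Ne.symm hv.2.2.1,
      Ne.symm hv.2.2.2]
  exact false_of_unique_edge hsymm hZ hnd (hcover p) (hcover q) he hpq hother
end

section
/- Let K be the field of Hahn series over ℂ with real exponents, with degree map deg : K → ℝ ∪ {∞}, and let L ⊆ Kⁿ be a K-linear subspace. Then every nonzero v ∈ L can be written as a finite sum v = v¹ + ⋯ + v^m of cocircuits vⁱ of L such that deg(v) is the coordinatewise minimum of deg(v¹), …, deg(v^m), i.e., deg(v_j) = min_i deg(vⁱ_j) for every coordinate j ∈ {1, …, n}. -/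
/-- The field of Hahn series over `ℂ` with real exponents (generalized Puiseux series). -/
abbrev HK := HahnSeries ℝ ℂ

/-- The degree map, sending a nonzero Hahn series to its least exponent and `0` to `∞`. -/
noncomputable def deg (v : HK) : WithTop ℝ := v.orderTop

/-- A cocircuit of a subspace `L ⊆ Kⁿ`: a nonzero element of `L` whose support is
minimal with respect to inclusion among supports of nonzero elements of `L`. -/
def IsCocircuit {n : ℕ} (L : Submodule HK (Fin n → HK)) (v : Fin n → HK) : Prop :=
  v ∈ L ∧ v ≠ 0 ∧ ∀ w : Fin n → HK, w ∈ L → w ≠ 0 →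
    {j | w j ≠ 0} ⊆ {j | v j ≠ 0} → {j | w j ≠ 0} = {j | v j ≠ 0}

/-- If `v` is a sum of vectors whose entrywise degrees are at least those of `v`, then the degree
of `v` is the entrywise minimum of their degrees. -/
theorem deg_sum_apply_eq_inf {n m : ℕ} (v : Fin n → HK) (c : Fin m → Fin n → HK)
    (hsum : v = ∑ i, c i) (hle : ∀ i j, deg (v j) ≤ deg (c i j)) (j : Fin n) :
    deg (v j) = Finset.univ.inf fun i : Fin m => deg (c i j) := by
  refine le_antisymm (Finset.le_inf fun i _ => hle i j) ?_
  rw [hsum, Finset.sum_apply]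
  refine Finset.sum_induction (fun i => c i j)
    (fun x => (Finset.univ.inf fun i : Fin m => deg (c i j)) ≤ deg x) ?_ ?_ ?_
  · intro a b ha hb
    exact (le_min ha hb).trans HahnSeries.min_orderTop_le_orderTop_add
  · simp [deg]
  · intro i hi
    exact Finset.inf_le (f := fun i : Fin m => deg (c i j)) hi

/-- A nonzero vector supported in the support of `v` can be rescaled so that its degrees are at
least those of `v` and it agrees with `v` at some coordinate of its support. -/
theorem exists_smul_apply_eq_and_deg_le {n : ℕ} (v w : Fin n → HK) (hw0 : w ≠ 0)
    (hwv : {j | w j ≠ 0} ⊆ {j | v j ≠ 0}) :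
    ∃ (a : HK) (j : Fin n), a ≠ 0 ∧ w j ≠ 0 ∧ a * w j = v j ∧
      ∀ k, deg (v k) ≤ deg (a * w k) := by
  classical
  obtain ⟨i, hi⟩ := Function.ne_iff.mp hw0
  obtain ⟨j, hj, hmin⟩ := Finset.exists_min_image (Finset.univ.filter fun k => w k ≠ 0)
    (fun k => deg (w k / v k)) ⟨i, by simpa using hi⟩
  have hwj : w j ≠ 0 := by simpa using hj
  have hvj : v j ≠ 0 := hwv hwj
  refine ⟨v j / w j, j, div_ne_zero hvj hwj, hwj, div_mul_cancel₀ _ hwj, fun k => ?_⟩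
  by_cases hwk : w k = 0
  · simp [hwk, deg]
  have hvk : v k ≠ 0 := hwv hwk
  have hk : deg (w j / v j) ≤ deg (w k / v k) := hmin k (by simpa using hwk)
  have hinv : deg (w j / v j) + deg (v j / w j) = 0 := by
    rw [deg, deg, ← HahnSeries.orderTop_mul, div_mul_div_cancel₀ hvj, div_self hwj,
      HahnSeries.orderTop_one]
  calc deg (v k) = deg (v k) + (deg (w j / v j) + deg (v j / w j)) := by rw [hinv, add_zero]
    _ ≤ deg (v k) + (deg (w k / v k) + deg (v j / w j)) := by gcongr
    _ = deg (v k * (w k / v k * (v j / w j))) := by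
      simp only [deg, HahnSeries.orderTop_mul]
    _ = deg (v j / w j * w k) := by
      congr 1
      field_simp

/-- Every vector of `L` is the sum of a list of cocircuits whose degrees are at least its own. -/
theorem exists_list_isCocircuit_sum_eq {n : ℕ} (L : Submodule HK (Fin n → HK)) (v : Fin n → HK)
    (hv : v ∈ L) :
    ∃ l : List (Fin n → HK), (∀ c ∈ l, IsCocircuit L c ∧ ∀ j, deg (v j) ≤ deg (c j)) ∧
      l.sum = v := by
  induction h : {j | v j ≠ 0}.ncard using Nat.strong_induction_on generalizing v with
  | _ N ih =>
  subst h
  by_cases hv0 : v = 0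
  · exact ⟨[], by simp [hv0]⟩
  by_cases hc : IsCocircuit L v
  · exact ⟨[v], by simp [hc]⟩
  obtain ⟨w, hw, hw0, hwv, hne⟩ : ∃ w ∈ L, w ≠ 0 ∧ {j | w j ≠ 0} ⊆ {j | v j ≠ 0} ∧
      {j | w j ≠ 0} ≠ {j | v j ≠ 0} := by
    simpa [IsCocircuit, hv, hv0] using hc
  obtain ⟨a, j, ha, hwj, haj, hle⟩ := exists_smul_apply_eq_and_deg_le v w hw0 hwv
  have hle' (k : Fin n) : deg (v k) ≤ deg ((v - a • w) k) :=
    (le_min le_rfl (hle k)).trans HahnSeries.min_orderTop_le_orderTop_sub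
  have hcard : {k | (a • w) k ≠ 0}.ncard < {k | v k ≠ 0}.ncard := by
    refine Set.ncard_lt_ncard ?_ (Set.toFinite _)
    simpa [ha] using hwv.ssubset_of_ne hne
  have hcard' : {k | (v - a • w) k ≠ 0}.ncard < {k | v k ≠ 0}.ncard := by
    refine Set.ncard_lt_ncard ⟨fun k hk hvk => hk ?_, fun hsub => ?_⟩ (Set.toFinite _)
    · have hwk : w k = 0 := by_contra fun hwk => hwv hwk hvk
      simp [hvk, hwk]
    · exact hsub (hwv hwj) (by simp [haj])
  obtain ⟨l₁, hl₁, hs₁⟩ := ih _ hcard (a • w) (L.smul_mem a hw) rfl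
  obtain ⟨l₂, hl₂, hs₂⟩ := ih _ hcard' (v - a • w) (L.sub_mem hv (L.smul_mem a hw)) rfl
  refine ⟨l₁ ++ l₂, fun c hc => ?_, by simp [hs₁, hs₂]⟩
  rcases List.mem_append.mp hc with hc | hc
  · exact ⟨(hl₁ c hc).1, fun k => (hle k).trans ((hl₁ c hc).2 k)⟩
  · exact ⟨(hl₂ c hc).1, fun k => (hle' k).trans ((hl₂ c hc).2 k)⟩

/-- every nonzero `v` in a subspace `L ⊆ Kⁿ` is a finite sum of
cocircuits `v = v¹ + ⋯ + v^m` with `deg (v j) = min_i deg (vⁱ j)` for every `j`. -/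
theorem stmt15 {n : ℕ} (L : Submodule HK (Fin n → HK)) (v : Fin n → HK)
    (hv : v ∈ L) (hv0 : v ≠ 0) :
    ∃ (m : ℕ) (c : Fin m → (Fin n → HK)),
      (∀ i, IsCocircuit L (c i)) ∧ v = ∑ i, c i ∧
      ∀ j : Fin n, deg (v j) = Finset.univ.inf fun i : Fin m => deg (c i j) := by
  obtain ⟨l, hl, hs⟩ := exists_list_isCocircuit_sum_eq L v hv
  have hsum : v = ∑ i : Fin l.length, l.get i := by
    rw [← hs, ← List.sum_ofFn, List.ofFn_get]
  exact ⟨l.length, l.get, fun i => (hl _ (l.get_mem i)).1, hsum,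
    deg_sum_apply_eq_inf v l.get hsum fun i => (hl _ (l.get_mem i)).2⟩
end

section
/- Let K be the field of Hahn series over ℂ with real exponents, with degree map deg : K → ℝ ∪ {∞}, let A be an n×d matrix over K, and let L ⊆ Kⁿ be the column space of A. Then deg(L) = im(deg(A)) — where deg(L) = {(deg(v₁), …, deg(vₙ)) : v ∈ L} and im(deg(A)) is the image of the tropical linear map (ℝ ∪ {∞})^d → (ℝ ∪ {∞})ⁿ sending v to the vector whose i-th coordinate is min_j (deg(A_{ij}) + v_j) — if and only if every cocircuit of L has a nonzero K-scalar multiple appearing as a column of A. -/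
lemma deg_eq_top {x : HK} : deg x = ⊤ ↔ x = 0 :=
  HahnSeries.orderTop_eq_top

lemma deg_mul (x y : HK) : deg (x * y) = deg x + deg y :=
  HahnSeries.orderTop_mul x y

lemma le_deg_add {x y : HK} {a : WithTop ℝ} (hx : a ≤ deg x) (hy : a ≤ deg y) :
    a ≤ deg (x + y) :=
  (le_min hx hy).trans HahnSeries.min_orderTop_le_orderTop_add

lemma lt_deg_add {x y : HK} {a : WithTop ℝ} (hx : a < deg x) (hy : a < deg y) :
    a < deg (x + y) :=
  (lt_min hx hy).trans_le HahnSeries.min_orderTop_le_orderTop_add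

lemma deg_neg (x : HK) : deg (-x) = deg x :=
  HahnSeries.orderTop_neg

lemma lt_deg_sub {x y : HK} {a : WithTop ℝ} (hx : a < deg x) (hy : a < deg y) :
    a < deg (x - y) := by
  rw [sub_eq_add_neg]
  exact lt_deg_add hx (by rwa [deg_neg])

lemma deg_C {t : ℂ} (ht : t ≠ 0) : deg (HahnSeries.C t) = 0 :=
  HahnSeries.orderTop_single ht

lemma deg_C_nonneg (t : ℂ) : 0 ≤ deg (HahnSeries.C t) := by
  rcases eq_or_ne t 0 with rfl | ht
  · rw [map_zero, deg_eq_top.2 rfl]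
    exact le_top
  · exact (deg_C ht).ge

lemma deg_div_nonneg {x y : HK} (hy : y ≠ 0) (h : deg y ≤ deg x) : 0 ≤ deg (x / y) := by
  have hxy : deg x = deg (x / y) + deg y := by rw [← deg_mul, div_mul_cancel₀ x hy]
  rw [hxy] at h
  refine (WithTop.add_le_add_iff_right (mt deg_eq_top.1 hy)).1 ?_
  rwa [zero_add]

lemma exists_deg_eq (a : WithTop ℝ) : ∃ c : HK, deg c = a := by
  induction a using WithTop.recTopCoe with
  | top => exact ⟨0, deg_eq_top.2 rfl⟩
  | coe r => exact ⟨HahnSeries.single r 1, HahnSeries.orderTop_single one_ne_zero⟩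

/-- A generic `ℂ`-combination of two vectors has no cancellation of leading terms. -/
lemma exists_deg_add_C_smul_eq_min {n : ℕ} (u v : Fin n → HK) :
    ∃ t : ℂ, ∀ i, deg ((u + (HahnSeries.C t : HK) • v) i) = min (deg (u i)) (deg (v i)) := by
  let bad (i : Fin n) : Set ℂ :=
    {t | min (deg (u i)) (deg (v i)) < deg (u i + HahnSeries.C t * v i)}
  have hbad (i : Fin n) : (bad i).Subsingleton := by
    intro s hs t ht
    by_contra hst
    have hv : min (deg (u i)) (deg (v i)) < deg (v i) := by
      have h := lt_deg_sub hs ht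
      have h_eq : u i + HahnSeries.C s * v i - (u i + HahnSeries.C t * v i) =
          HahnSeries.C (s - t) * v i := by
        rw [map_sub]
        ring
      rwa [h_eq, deg_mul, deg_C (sub_ne_zero.2 hst), zero_add] at h
    have hu : min (deg (u i)) (deg (v i)) < deg (u i) := by
      have hsv : min (deg (u i)) (deg (v i)) < deg (HahnSeries.C s * v i) := by
        rw [deg_mul]
        exact hv.trans_le (le_add_of_nonneg_left (deg_C_nonneg s))
      simpa using lt_deg_sub hs hsv
    exact lt_irrefl _ (lt_min hu hv)
  obtain ⟨t, ht⟩ := (Set.finite_iUnion fun i => (hbad i).finite).exists_notMem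
  refine ⟨t, fun i => le_antisymm (not_lt.1 fun h => ht (Set.mem_iUnion.2 ⟨i, h⟩)) ?_⟩
  refine le_deg_add (min_le_left _ _) ((min_le_right _ _).trans ?_)
  rw [Pi.smul_apply, smul_eq_mul, deg_mul]
  exact le_add_of_nonneg_left (deg_C_nonneg t)

/-- Tropical combinations of degree vectors of elements of `L` are degree vectors of
elements of `L`. -/
lemma exists_mem_deg_eq_inf {n : ℕ} {ι : Type*} (L : Submodule HK (Fin n → HK))
    (a : ι → Fin n → HK) (ha : ∀ j, a j ∈ L) (w : ι → WithTop ℝ) (s : Finset ι) :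
    ∃ v ∈ L, ∀ i, deg (v i) = s.inf fun j => deg (a j i) + w j := by
  classical
  induction s using Finset.induction_on with
  | empty => exact ⟨0, L.zero_mem, fun i => by simp [deg_eq_top]⟩
  | insert j s _ ih =>
    obtain ⟨v, hv, hdeg⟩ := ih
    obtain ⟨c, hc⟩ := exists_deg_eq (w j)
    obtain ⟨t, ht⟩ := exists_deg_add_C_smul_eq_min (c • a j) v
    refine ⟨_, L.add_mem (L.smul_mem c (ha j)) (L.smul_mem (HahnSeries.C t) hv), fun i => ?_⟩
    rw [ht, Finset.inf_insert, hdeg, Pi.smul_apply, smul_eq_mul, deg_mul, hc, add_comm]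

/-- A vector whose support strictly contains that of a nonzero `u` splits as a sum of two vectors
of strictly smaller support and no smaller degrees. -/
lemma exists_smul_deg_le_of_support_ssubset {n : ℕ} {u v : Fin n → HK} (hu : u ≠ 0)
    (huv : {j | u j ≠ 0} ⊂ {j | v j ≠ 0}) :
    ∃ c : HK, (∀ m, deg (v m) ≤ deg ((c • u) m)) ∧
      {j | (c • u) j ≠ 0} ⊂ {j | v j ≠ 0} ∧ {j | (v - c • u) j ≠ 0} ⊂ {j | v j ≠ 0} := by
  obtain ⟨i, hi⟩ := Function.ne_iff.1 hu
  obtain ⟨k, -, hk⟩ := Finset.exists_min_image Finset.univ (fun m => deg (u m / v m))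
    ⟨i, Finset.mem_univ i⟩
  have hzero {m : Fin n} (hm : v m = 0) : u m = 0 := by
    by_contra h
    exact huv.1 h hm
  have hvi : v i ≠ 0 := huv.1 hi
  have hq : u k / v k ≠ 0 := by
    intro h
    have h_top := hk i (Finset.mem_univ i)
    rw [h, deg_eq_top.2 rfl, top_le_iff, deg_eq_top] at h_top
    exact div_ne_zero hi hvi h_top
  have huk : u k ≠ 0 := fun h => hq (by rw [h, zero_div])
  have hvk : v k ≠ 0 := fun h => hq (by rw [h, div_zero])
  refine ⟨v k / u k, fun m => ?_, ?_, ?_⟩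
  · rcases eq_or_ne (v m) 0 with hm | hm
    · simp [hzero hm, hm]
    · have h_eq : ((v k / u k) • u) m = v m * ((u m / v m) / (u k / v k)) := by
        rw [Pi.smul_apply, smul_eq_mul]
        field_simp
      rw [h_eq, deg_mul]
      exact le_add_of_nonneg_right (deg_div_nonneg hq (hk m (Finset.mem_univ m)))
  · refine lt_of_le_of_lt (fun m hm => ?_) huv
    exact right_ne_zero_of_mul hm
  · refine ⟨fun m hm h => hm ?_, fun h => h hvk ?_⟩
    · simp [hzero h, h]
    · simp [div_mul_cancel₀ _ huk]

/-- Every element of `L` is dominated by a cocircuit agreeing with it in degree at a prescribed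
coordinate of its support. -/
lemma exists_isCocircuit_deg_le {n : ℕ} (L : Submodule HK (Fin n → HK)) (i : Fin n)
    (v : Fin n → HK) (hv : v ∈ L) (hi : v i ≠ 0) :
    ∃ u, IsCocircuit L u ∧ (∀ m, deg (v m) ≤ deg (u m)) ∧ deg (u i) = deg (v i) := by
  induction hs : {j | v j ≠ 0} using WellFoundedLT.induction generalizing v with
  | ind s ih =>
    subst hs
    by_cases hco : IsCocircuit L v
    · exact ⟨v, hco, fun _ => le_rfl, rfl⟩
    have hv0 : v ≠ 0 := Function.ne_iff.2 ⟨i, hi⟩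
    obtain ⟨u, hu, hu0, huv, hne⟩ : ∃ u ∈ L, u ≠ 0 ∧ {j | u j ≠ 0} ⊆ {j | v j ≠ 0} ∧
        {j | u j ≠ 0} ≠ {j | v j ≠ 0} := by
      by_contra! h
      exact hco ⟨hv, hv0, h⟩
    obtain ⟨c, hdeg, hsupp, hsupp'⟩ :=
      exists_smul_deg_le_of_support_ssubset hu0 (huv.ssubset_of_ne hne)
    have hdeg' (m : Fin n) : deg (v m) ≤ deg ((v - c • u) m) := by
      rw [Pi.sub_apply, sub_eq_add_neg]
      exact le_deg_add le_rfl ((hdeg m).trans_eq (deg_neg _).symm)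
    have key (x : Fin n → HK) (hx : x ∈ L) (hle : ∀ m, deg (v m) ≤ deg (x m))
        (hxv : {j | x j ≠ 0} ⊂ {j | v j ≠ 0}) (hxi : deg (x i) = deg (v i)) :
        ∃ u, IsCocircuit L u ∧ (∀ m, deg (v m) ≤ deg (u m)) ∧ deg (u i) = deg (v i) := by
      have hxi0 : x i ≠ 0 := by rwa [Ne, ← deg_eq_top, hxi, deg_eq_top]
      obtain ⟨y, hy, hxy, hyi⟩ := ih _ hxv x hx hxi0 rfl
      exact ⟨y, hy, fun m => (hle m).trans (hxy m), hyi.trans hxi⟩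
    rcases (hdeg i).eq_or_lt with h | h
    · exact key _ (L.smul_mem c hu) hdeg hsupp h.symm
    rcases (hdeg' i).eq_or_lt with h' | h'
    · exact key _ (L.sub_mem hv (L.smul_mem c hu)) hdeg' hsupp' h'.symm
    · exact absurd (lt_deg_add h' h) (by simp)

/-- An element of `L` whose support lies in that of a cocircuit is a multiple of it. -/
lemma IsCocircuit.exists_eq_smul {n : ℕ} {L : Submodule HK (Fin n → HK)} {v u : Fin n → HK}
    (hv : IsCocircuit L v) (hu : u ∈ L) (hu0 : u ≠ 0) (huv : {j | u j ≠ 0} ⊆ {j | v j ≠ 0}) :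
    ∃ c : HK, c ≠ 0 ∧ u = c • v := by
  obtain ⟨i, hi⟩ := Function.ne_iff.1 hu0
  have hvi : v i ≠ 0 := huv hi
  refine ⟨u i / v i, div_ne_zero hi hvi, ?_⟩
  by_contra hne
  have hsub : {j | (u - (u i / v i) • v) j ≠ 0} ⊆ {j | v j ≠ 0} := by
    intro m hm h
    have hum : u m = 0 := by
      by_contra h'
      exact huv h' h
    exact hm (by simp [hum, h])
  have h_eq := hv.2.2 _ (L.sub_mem hu (L.smul_mem (u i / v i) hv.1)) (sub_ne_zero.2 hne) hsub
  have h_mem : i ∈ {j | (u - (u i / v i) • v) j ≠ 0} := h_eq ▸ hvi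
  exact h_mem (by simp [div_mul_cancel₀ _ hvi])

/-- If the columns `a j` contain a multiple of every cocircuit of `L`, then the degree vector of
every element of `L` is a tropical combination of the degree vectors of the `a j`. -/
lemma exists_deg_eq_inf_of_isCocircuit {n d : ℕ} {L : Submodule HK (Fin n → HK)}
    {a : Fin d → Fin n → HK}
    (ha : ∀ v, IsCocircuit L v → ∃ (j : Fin d) (c : HK), c ≠ 0 ∧ a j = c • v)
    {v : Fin n → HK} (hv : v ∈ L) :
    ∃ w : Fin d → WithTop ℝ, ∀ i, deg (v i) = Finset.univ.inf fun j => deg (a j i) + w j := by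
  classical
  have hex (i : {i // v i ≠ 0}) : ∃ (j : Fin d) (b : WithTop ℝ),
      (∀ m, deg (v m) ≤ deg (a j m) + b) ∧ deg (a j i) + b = deg (v i) := by
    obtain ⟨u, hu, hle, hi⟩ := exists_isCocircuit_deg_le L i v hv i.2
    obtain ⟨j, c, hc, hj⟩ := ha u hu
    have hdeg (m : Fin n) : deg (a j m) + deg c⁻¹ = deg (u m) := by
      rw [← deg_mul, hj, Pi.smul_apply, smul_eq_mul, mul_comm, inv_mul_cancel_left₀ hc]
    exact ⟨j, deg c⁻¹, fun m => (hle m).trans_eq (hdeg m).symm, (hdeg i).trans hi⟩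
  choose j b hle heq using hex
  refine ⟨fun k => (Finset.univ.filter fun i => j i = k).inf b, fun m => le_antisymm ?_ ?_⟩
  · refine Finset.le_inf fun k _ => ?_
    rcases (Finset.univ.filter fun i => j i = k).eq_empty_or_nonempty with h | h
    · simp [h]
    · obtain ⟨i, hi, hmin⟩ := Finset.exists_mem_eq_inf _ h b
      dsimp only
      rw [hmin, ← (Finset.mem_filter.1 hi).2]
      exact hle i m
  · rcases eq_or_ne (v m) 0 with hm | hm
    · rw [deg_eq_top.2 hm]
      exact le_top
    · refine (Finset.inf_le (Finset.mem_univ (j ⟨m, hm⟩))).trans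
        (le_trans ?_ (heq ⟨m, hm⟩).le)
      gcongr
      exact Finset.inf_le (by simp)

/-- If the degree vector of a cocircuit is a tropical combination of the degree vectors of
elements `a j` of `L`, then some `a j` is a multiple of it. -/
lemma IsCocircuit.exists_eq_smul_of_deg_eq_inf {n d : ℕ} {L : Submodule HK (Fin n → HK)}
    {a : Fin d → Fin n → HK} (ha : ∀ j, a j ∈ L) {v : Fin n → HK} (hv : IsCocircuit L v)
    {w : Fin d → WithTop ℝ}
    (hw : ∀ i, deg (v i) = Finset.univ.inf fun j => deg (a j i) + w j) :
    ∃ (j : Fin d) (c : HK), c ≠ 0 ∧ a j = c • v := by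
  obtain ⟨i, hi⟩ := Function.ne_iff.1 hv.2.1
  have hi_top : deg (v i) ≠ ⊤ := mt deg_eq_top.1 hi
  have hne : (Finset.univ : Finset (Fin d)).Nonempty := by
    by_contra h
    rw [hw, Finset.not_nonempty_iff_eq_empty.1 h, Finset.inf_empty] at hi_top
    exact hi_top rfl
  obtain ⟨j, -, hj⟩ := Finset.exists_mem_eq_inf _ hne fun j => deg (a j i) + w j
  rw [hw, hj, WithTop.add_ne_top] at hi_top
  refine ⟨j, hv.exists_eq_smul (ha j) (Function.ne_iff.2 ⟨i, mt deg_eq_top.2 hi_top.1⟩) ?_⟩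
  intro m hm h
  have hle : deg (v m) ≤ deg (a j m) + w j := by
    rw [hw]
    exact Finset.inf_le (Finset.mem_univ j)
  rw [deg_eq_top.2 h, top_le_iff, WithTop.add_eq_top] at hle
  exact hle.elim (mt deg_eq_top.1 hm) hi_top.2

/-- for an `n × d` matrix `A` over `K` with column space `L`, the
tropicalization `deg(L)` equals the image of the tropical linear map of `deg(A)`
(sending `w` to the vector with `i`-th coordinate `min_j (deg (A i j) + w j)`) iff
every cocircuit of `L` has a nonzero scalar multiple appearing as a column of `A`. -/
theorem stmt16 {n d : ℕ} (A : Matrix (Fin n) (Fin d) HK)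
    (L : Submodule HK (Fin n → HK)) (hL : L = LinearMap.range A.mulVecLin) :
    {x : Fin n → WithTop ℝ | ∃ v ∈ L, x = fun i => deg (v i)} =
      {x : Fin n → WithTop ℝ | ∃ w : Fin d → WithTop ℝ,
        x = fun i => Finset.univ.inf fun j : Fin d => deg (A i j) + w j} ↔
    ∀ v : Fin n → HK, IsCocircuit L v →
      ∃ (j : Fin d) (c : HK), c ≠ 0 ∧ (fun i => A i j) = c • v := by
  have hcol (j : Fin d) : A.col j ∈ L := by
    rw [hL]
    exact ⟨Pi.single j 1, by simp⟩
  constructor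
  · intro h v hv
    obtain ⟨w, hw⟩ := h.subset ⟨v, hv.1, rfl⟩
    exact hv.exists_eq_smul_of_deg_eq_inf hcol (congrFun hw)
  · intro h
    refine Set.Subset.antisymm ?_ ?_
    · rintro _ ⟨v, hv, rfl⟩
      obtain ⟨w, hw⟩ := exists_deg_eq_inf_of_isCocircuit (a := A.col) h hv
      exact ⟨w, funext hw⟩
    · rintro _ ⟨w, rfl⟩
      obtain ⟨v, hv, hdeg⟩ := exists_mem_deg_eq_inf L A.col hcol w Finset.univ
      exact ⟨v, hv, funext fun i => (hdeg i).symm⟩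
end

section
/- Let M be a matroid on a finite set E with circuit family 𝒞, let ℬ ⊆ 𝒞, and suppose x : E → ℝ lies in T(ℬ) but not in T(𝒞), so some circuit C ∈ 𝒞 \ ℬ has a unique minimum m of x over C. Define the 0/1-vector v : E → ℝ by v_i = 1 if x_i > m and v_i = 0 if x_i ≤ m. Then v lies in T(ℬ) but not in T(𝒞); in particular, if T(ℬ) ≠ T(𝒞) then the two sets differ at a 0/1-vector. -/
/-- Thresholding a vector at a level `m` preserves attaining the minimum twice. -/
theorem AttainsMinTwice.threshold {α : Type*} {D : Set α} {x : α → ℝ}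
    (h : AttainsMinTwice D x) (m : ℝ) :
    AttainsMinTwice D (fun i => if x i ≤ m then (0 : ℝ) else 1) := by
  obtain ⟨i, hi, j, hj, hij, hxij, hmin⟩ := h
  refine ⟨i, hi, j, hj, hij, by simp only [hxij], fun k hk => ?_⟩
  have := hmin k hk
  dsimp only
  split_ifs <;> linarith

/-- A vector with a unique minimizer on `C` does not attain its minimum on `C` twice. -/
theorem not_attainsMinTwice_of_unique {α : Type*} {C : Set α} {x : α → ℝ} {e : α}
    (he : e ∈ C) (huniq : ∀ f ∈ C, f ≠ e → x e < x f) : ¬ AttainsMinTwice C x := by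
  rintro ⟨i, hi, j, hj, hij, hxij, hmin⟩
  have hie : i = e := by
    by_contra h
    exact (huniq i hi h).not_ge (hmin e he)
  subst hie
  exact (huniq j hj hij.symm).ne hxij

/-- On a nonempty finite set, a vector not attaining its minimum twice has a unique minimizer. -/
theorem exists_unique_min_of_not_attainsMinTwice {α : Type*} {C : Set α} {x : α → ℝ}
    (hfin : C.Finite) (hne : C.Nonempty) (h : ¬ AttainsMinTwice C x) :
    ∃ e ∈ C, ∀ f ∈ C, f ≠ e → x e < x f := by
  obtain ⟨e, he, hmin⟩ := Set.exists_min_image C x hfin hne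
  refine ⟨e, he, fun f hf hfe => (hmin f hf).lt_of_ne fun hef => h ?_⟩
  exact ⟨e, he, f, hf, hfe.symm, hef, hmin⟩

/-- Thresholding at a unique minimum over `C` stays in `T(ℬ)` and is still excluded by `C`. -/
theorem threshold_mem_tropT_and_notMem {α : Type*} {ℬ 𝒞 : Set (Set α)} {x : α → ℝ}
    (hx : x ∈ tropT ℬ) {C : Set α} (hC : C ∈ 𝒞) {e : α} (he : e ∈ C)
    (huniq : ∀ f ∈ C, f ≠ e → x e < x f) :
    (fun i => if x i ≤ x e then (0 : ℝ) else 1) ∈ tropT ℬ ∧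
      (fun i => if x i ≤ x e then (0 : ℝ) else 1) ∉ tropT 𝒞 := by
  refine ⟨fun D hD => (hx D hD).threshold _, fun h => ?_⟩
  refine not_attainsMinTwice_of_unique he (fun f hf hfe => ?_) (h C hC)
  simp [(huniq f hf hfe).not_ge]

/-- let `M` be a matroid on a finite set with circuit family `𝒞`, let
`ℬ ⊆ 𝒞`, and let `x ∈ T(ℬ)` be excluded by a circuit `C ∈ 𝒞 \ ℬ` on which `x` has a
unique minimum `m = x e`. Then the 0/1-vector `v` (with `v i = 0` iff `x i ≤ m`) lies
in `T(ℬ)` but not in `T(𝒞)`; in particular, if `T(ℬ) ≠ T(𝒞)` then the two sets differ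
at a 0/1-vector. -/
theorem stmt17 {α : Type*} [Fintype α] (M : Matroid α) (𝒞 : Set (Set α))
    (h𝒞 : 𝒞 = {C | MatroidCircuit M C}) (ℬ : Set (Set α)) (hℬ : ℬ ⊆ 𝒞)
    (x : α → ℝ) (hx : x ∈ tropT ℬ) (C : Set α) (hC : C ∈ 𝒞) (hCB : C ∉ ℬ)
    (e : α) (he : e ∈ C) (huniq : ∀ f ∈ C, f ≠ e → x e < x f)
    (v : α → ℝ) (hv : v = fun i => if x i ≤ x e then (0 : ℝ) else 1) :
    (v ∈ tropT ℬ ∧ v ∉ tropT 𝒞) ∧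
    ∀ ℬ' : Set (Set α), ℬ' ⊆ 𝒞 → tropT ℬ' ≠ tropT 𝒞 →
      ∃ w : α → ℝ, (∀ i, w i = 0 ∨ w i = 1) ∧ w ∈ tropT ℬ' ∧ w ∉ tropT 𝒞 := by
  subst hv h𝒞
  refine ⟨threshold_mem_tropT_and_notMem hx hC he huniq, fun ℬ' hℬ' hne => ?_⟩
  have hsub : tropT {C | MatroidCircuit M C} ⊆ tropT ℬ' := fun y hy D hD => hy D (hℬ' hD)
  obtain ⟨y, hy, hy'⟩ := Set.exists_of_ssubset (hsub.ssubset_of_ne hne.symm)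
  obtain ⟨D, hD, hyD⟩ : ∃ D, MatroidCircuit M D ∧ ¬ AttainsMinTwice D y := by
    simpa [tropT] using hy'
  obtain ⟨d, hd, hmin⟩ :=
    exists_unique_min_of_not_attainsMinTwice D.toFinite hD.prop.nonempty hyD
  refine ⟨_, fun i => ?_, threshold_mem_tropT_and_notMem hy hD hd hmin⟩
  split_ifs <;> simp
end
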